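/- Let β > 0, α > 0, σ > 0, and let (μ_n) be a sequence of nonnegative reals with μ_n/n → α. Let σ ≤ a < b satisfy ψ_α(b, a) = 0, φ_α(b, a) ≥ 0, and (a = σ or φ_α(b, a) = 0). For each n let P_n be the Borel probability measure on [σ, ∞)^n with density proportional to ∏ᵢ xᵢ^{βμ_n}·exp(−(nβ/2)·Σᵢ xᵢ²)·∏_{i<j} |xᵢ − xⱼ|^β. Then for every bounded continuous function φ : ℝ → ℝ, lim_{n→∞} ∫ (1/n)·Σᵢ φ(xᵢ) dP_n(x) = ∫_a^b φ(x)·f_{α,a,b}(x) dx; that is, the mean empirical measure of the eigenvalues conditioned to lie in [σ, ∞) converges tightly to the measure with density f_{α,a,b} on (a, b]. -/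

import Mathlib

open Filter Topology

/-- `φ_α(x, a) = x + a − 2α/√(ax)` -/
noncomputable def phiFun (α x a : ℝ) : ℝ := x + a - 2 * α / Real.sqrt (a * x)

/-- `ψ_α(x, a) = (3/4)(x−a)² + a(x−a) + 2α√a/√x − 2α − 2` -/
noncomputable def psiFun (α x a : ℝ) : ℝ :=
  (3 / 4) * (x - a) ^ 2 + a * (x - a) + 2 * α * Real.sqrt a / Real.sqrt x - 2 * α - 2

/-- `f_{α,a,b}(x) = (1/(2π))·√((b−x)/(x−a))·(2x + b − a − 2α√(a/b)/x)` -/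
noncomputable def densF (α a b x : ℝ) : ℝ :=
  (1 / (2 * Real.pi)) * Real.sqrt ((b - x) / (x - a)) *
    (2 * x + b - a - 2 * α * Real.sqrt (a / b) / x)

/-- Unnormalized eigenvalue density of the generalized Gaussian β-ensemble:
`∏ᵢ xᵢ^(βμ) exp(−(nβ/2) Σ xᵢ²) ∏_{i<j} |xᵢ−xⱼ|^β`. -/
noncomputable def eigDens (β μn : ℝ) (n : ℕ) (x : Fin n → ℝ) : ℝ :=
  (∏ i, x i ^ (β * μn)) * Real.exp (-(n * β / 2) * ∑ i, x i ^ 2) *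
    ∏ i, ∏ j ∈ Finset.Ioi i, |x i - x j| ^ β

namespace BetaEnsemble

open MeasureTheory Set Filter Topology ProbabilityTheory

/-- The logarithm of the distance, smoothed at scale `ε`. -/
noncomputable def logReg (ε u : ℝ) : ℝ := Real.log (u ^ 2 + ε ^ 2) / 2

/-- The quadratic form `∬ K(x - y) d(μ - ν)(x) d(μ - ν)(y)` of an even kernel `K`. -/
noncomputable def pairEnergy (K : ℝ → ℝ) (μ ν : Measure ℝ) : ℝ :=
  (∫ z, K (z.1 - z.2) ∂(μ.prod μ)) - 2 * (∫ z, K (z.1 - z.2) ∂(μ.prod ν))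
    + ∫ z, K (z.1 - z.2) ∂(ν.prod ν)

lemma continuous_logReg {ε : ℝ} (hε : 0 < ε) : Continuous (logReg ε) := by
  unfold logReg
  refine (Continuous.log (by fun_prop) fun u => ?_).div_const _
  positivity

lemma integral_exp_neg_mul_cos {t : ℝ} (ht : 0 < t) (u : ℝ) :
    ∫ k in Ioi (0 : ℝ), Real.exp (-(t * k)) * Real.cos (k * u) = t / (u ^ 2 + t ^ 2) := by
  have ha : (⟨-t, u⟩ : ℂ).re < 0 := by simpa using ht
  have h := integral_exp_mul_complex_Ioi ha 0
  have hi := integrableOn_exp_mul_complex_Ioi ha 0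
  have h2 := congrArg Complex.re h
  rw [← RCLike.re_to_complex, ← integral_re hi] at h2
  have e : ∀ k : ℝ, RCLike.re (Complex.exp ((⟨-t, u⟩ : ℂ) * k)) =
      Real.exp (-(t * k)) * Real.cos (k * u) := by
    intro k
    rw [RCLike.re_to_complex, Complex.exp_re]
    simp [mul_comm]
  simp only [e] at h2
  rw [h2, Complex.ofReal_zero, mul_zero, Complex.exp_zero, Complex.div_re]
  simp [Complex.normSq_apply]
  have : u ^ 2 + t ^ 2 ≠ 0 := by positivity
  have h3 : t * t + u * u ≠ 0 := by nlinarith [sq_nonneg u, mul_pos ht ht]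
  field_simp
  ring

lemma integrable_exp_neg_mul_prod {ε : ℝ} (hε : 0 < ε) (R : ℝ) :
    Integrable (fun p : ℝ × ℝ => Real.exp (-(p.1 * p.2)))
      ((volume.restrict (Ioc ε R)).prod (volume.restrict (Ioi 0))) := by
  have h : Integrable (fun p : ℝ × ℝ => (1 : ℝ) * Real.exp (-ε * p.2))
      ((volume.restrict (Ioc ε R)).prod (volume.restrict (Ioi 0))) :=
    Integrable.mul_prod (f := fun _ => (1 : ℝ)) (g := fun k => Real.exp (-ε * k))
      (integrable_const _) (exp_neg_integrableOn_Ioi 0 hε)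
  refine h.mono' (by fun_prop) ?_
  rw [Measure.prod_restrict]
  filter_upwards [ae_restrict_mem (measurableSet_Ioc.prod measurableSet_Ioi)] with p hp
  rw [Real.norm_of_nonneg (Real.exp_pos _).le, one_mul]
  have h1 : ε < p.1 := hp.1.1
  have h2 : 0 < p.2 := hp.2
  apply Real.exp_le_exp.2
  nlinarith

lemma logReg_sub_logReg {ε R : ℝ} (hε : 0 < ε) (hR : ε ≤ R) (u : ℝ) :
    logReg R u - logReg ε u =
      ∫ p : ℝ × ℝ, Real.exp (-(p.1 * p.2)) * Real.cos (p.2 * u)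
        ∂((volume.restrict (Ioc ε R)).prod (volume.restrict (Ioi 0))) := by
  have hint : Integrable (fun p : ℝ × ℝ => Real.exp (-(p.1 * p.2)) * Real.cos (p.2 * u))
      ((volume.restrict (Ioc ε R)).prod (volume.restrict (Ioi 0))) := by
    refine (integrable_exp_neg_mul_prod hε R).mono (by fun_prop) (ae_of_all _ fun p => ?_)
    rw [norm_mul]
    exact mul_le_of_le_one_right (norm_nonneg _) (Real.abs_cos_le_one _)
  rw [integral_prod _ hint]
  have e : ∫ t in Ioc ε R, ∫ k in Ioi (0 : ℝ), Real.exp (-(t * k)) * Real.cos (k * u) =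
      ∫ t in Ioc ε R, t / (u ^ 2 + t ^ 2) :=
    setIntegral_congr_fun measurableSet_Ioc fun t ht =>
      integral_exp_neg_mul_cos (hε.trans ht.1) u
  simp only at e ⊢
  rw [e, ← intervalIntegral.integral_of_le hR]
  symm
  have hpos : ∀ t ∈ uIcc ε R, 0 < t := fun t ht => by
    rw [uIcc_of_le hR] at ht; exact hε.trans_le ht.1
  refine intervalIntegral.integral_eq_sub_of_hasDerivAt (f := fun t => logReg t u) ?_ ?_
  · intro t ht
    have h0 := hpos t ht
    have hne : u ^ 2 + t ^ 2 ≠ 0 := by positivity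
    have h1 : HasDerivAt (fun t : ℝ => u ^ 2 + t ^ 2) (2 * t) t := by
      simpa using (hasDerivAt_pow 2 t).const_add (u ^ 2)
    have h2 : HasDerivAt (fun t => logReg t u) (2 * t / (u ^ 2 + t ^ 2) / 2) t :=
      (h1.log hne).div_const 2
    rwa [show 2 * t / (u ^ 2 + t ^ 2) / 2 = t / (u ^ 2 + t ^ 2) by ring] at h2
  · refine ContinuousOn.intervalIntegrable ?_
    refine continuousOn_id.div (by fun_prop) fun t ht => ?_
    have h0 := hpos t ht
    positivity

lemma integrable_cos_mul (μ : Measure ℝ) [IsFiniteMeasure μ] (k : ℝ) :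
    Integrable (fun x => Real.cos (k * x)) μ :=
  (integrable_const (1 : ℝ)).mono' (by fun_prop) (ae_of_all _ fun _ => Real.abs_cos_le_one _)

lemma integrable_sin_mul (μ : Measure ℝ) [IsFiniteMeasure μ] (k : ℝ) :
    Integrable (fun x => Real.sin (k * x)) μ :=
  (integrable_const (1 : ℝ)).mono' (by fun_prop) (ae_of_all _ fun _ => Real.abs_sin_le_one _)

lemma charFun_re_im (μ : Measure ℝ) [IsFiniteMeasure μ] (k : ℝ) :
    (charFun μ k).re = ∫ x, Real.cos (k * x) ∂μ ∧ (charFun μ k).im = ∫ x, Real.sin (k * x) ∂μ := by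
  have hi : Integrable (fun x : ℝ => Complex.exp (k * x * Complex.I)) μ := by
    refine (integrable_const (1 : ℝ)).mono' (by fun_prop) (ae_of_all _ fun x => ?_)
    rw [← Complex.ofReal_mul, Complex.norm_exp_ofReal_mul_I]
  rw [charFun_apply_real]
  constructor
  · rw [← RCLike.re_to_complex, ← integral_re hi]
    refine integral_congr_ae (ae_of_all _ fun x => ?_)
    simp only [RCLike.re_to_complex]
    rw [← Complex.ofReal_mul, Complex.exp_ofReal_mul_I_re]
  · rw [← RCLike.im_to_complex, ← integral_im hi]
    refine integral_congr_ae (ae_of_all _ fun x => ?_)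
    simp only [RCLike.im_to_complex]
    rw [← Complex.ofReal_mul, Complex.exp_ofReal_mul_I_im]

lemma integral_cos_sub_prod (μ ν : Measure ℝ) [IsFiniteMeasure μ] [IsFiniteMeasure ν] (k : ℝ) :
    ∫ z, Real.cos (k * (z.1 - z.2)) ∂(μ.prod ν) =
      (∫ x, Real.cos (k * x) ∂μ) * (∫ x, Real.cos (k * x) ∂ν)
        + (∫ x, Real.sin (k * x) ∂μ) * (∫ x, Real.sin (k * x) ∂ν) := by
  have e : ∀ z : ℝ × ℝ, Real.cos (k * (z.1 - z.2)) =
      Real.cos (k * z.1) * Real.cos (k * z.2) + Real.sin (k * z.1) * Real.sin (k * z.2) := by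
    intro z
    rw [mul_sub, Real.cos_sub]
  simp only [e]
  rw [integral_add ((integrable_cos_mul μ k).mul_prod (integrable_cos_mul ν k))
    ((integrable_sin_mul μ k).mul_prod (integrable_sin_mul ν k)),
    integral_prod_mul (fun x => Real.cos (k * x)) (fun x => Real.cos (k * x)),
    integral_prod_mul (fun x => Real.sin (k * x)) (fun x => Real.sin (k * x))]

lemma pairEnergy_cos (μ ν : Measure ℝ) [IsFiniteMeasure μ] [IsFiniteMeasure ν] (k : ℝ) :
    pairEnergy (fun u => Real.cos (k * u)) μ ν = ‖charFun μ k - charFun ν k‖ ^ 2 := by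
  rw [pairEnergy, integral_cos_sub_prod, integral_cos_sub_prod, integral_cos_sub_prod,
    ← Complex.normSq_eq_norm_sq, Complex.normSq_apply, Complex.sub_re, Complex.sub_im,
    (charFun_re_im μ k).1, (charFun_re_im μ k).2, (charFun_re_im ν k).1, (charFun_re_im ν k).2]
  ring

lemma integral_logReg_sub_prod {ε R : ℝ} (hε : 0 < ε) (hR : ε ≤ R) (μ ν : Measure ℝ)
    [IsFiniteMeasure μ] [IsFiniteMeasure ν] :
    Integrable (fun p : ℝ × ℝ => Real.exp (-(p.1 * p.2)) *
        ∫ z, Real.cos (p.2 * (z.1 - z.2)) ∂(μ.prod ν))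
        ((volume.restrict (Ioc ε R)).prod (volume.restrict (Ioi 0))) ∧
    ∫ z, (logReg R (z.1 - z.2) - logReg ε (z.1 - z.2)) ∂(μ.prod ν) =
      ∫ p : ℝ × ℝ, Real.exp (-(p.1 * p.2)) * ∫ z, Real.cos (p.2 * (z.1 - z.2)) ∂(μ.prod ν)
        ∂((volume.restrict (Ioc ε R)).prod (volume.restrict (Ioi 0))) := by
  have hint : Integrable (fun q : (ℝ × ℝ) × (ℝ × ℝ) =>
      Real.exp (-(q.2.1 * q.2.2)) * Real.cos (q.2.2 * (q.1.1 - q.1.2)))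
      ((μ.prod ν).prod ((volume.restrict (Ioc ε R)).prod (volume.restrict (Ioi 0)))) := by
    have h := Integrable.mul_prod (μ := μ.prod ν) (integrable_const (1 : ℝ))
      (integrable_exp_neg_mul_prod hε R)
    refine h.mono (by fun_prop) (ae_of_all _ fun q => ?_)
    rw [norm_mul, one_mul]
    exact mul_le_of_le_one_right (norm_nonneg _) (Real.abs_cos_le_one _)
  have h1 := integral_integral_swap
    (f := fun (z p : ℝ × ℝ) => Real.exp (-(p.1 * p.2)) * Real.cos (p.2 * (z.1 - z.2))) hint
  have h2 := hint.integral_prod_right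
  simp only [integral_const_mul] at h1 h2
  refine ⟨h2, ?_⟩
  rw [← h1]
  simp only [logReg_sub_logReg hε hR]

lemma abs_logReg_le {ε : ℝ} (hε : 0 < ε) (u : ℝ) : |logReg ε u| ≤ |Real.log ε| + u ^ 2 / ε ^ 2 := by
  have h1 : u ^ 2 + ε ^ 2 = ε ^ 2 * (1 + u ^ 2 / ε ^ 2) := by field_simp; ring
  have hq : 0 ≤ u ^ 2 / ε ^ 2 := by positivity
  have h2 : logReg ε u = Real.log ε + Real.log (1 + u ^ 2 / ε ^ 2) / 2 := by
    rw [logReg, h1, Real.log_mul (by positivity) (by positivity), Real.log_pow]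
    push_cast
    ring
  rw [h2]
  refine (abs_add_le _ _).trans (add_le_add le_rfl ?_)
  have h3 := Real.log_nonneg (by linarith : 1 ≤ 1 + u ^ 2 / ε ^ 2)
  have h4 := Real.log_le_sub_one_of_pos (by linarith : 0 < 1 + u ^ 2 / ε ^ 2)
  rw [abs_of_nonneg (by positivity)]
  linarith

lemma integrable_sub_sq_prod {μ ν : Measure ℝ} [IsFiniteMeasure μ] [IsFiniteMeasure ν]
    (hμ : Integrable (fun x => x ^ 2) μ) (hν : Integrable (fun x => x ^ 2) ν) :
    Integrable (fun z : ℝ × ℝ => (z.1 - z.2) ^ 2) (μ.prod ν) := by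
  have h1 := (hμ.mul_prod (integrable_const (μ := ν) (1 : ℝ))).const_mul 2
  have h2 := ((integrable_const (μ := μ) (1 : ℝ)).mul_prod hν).const_mul 2
  refine (h1.add h2).mono' (by fun_prop) (ae_of_all _ fun z => ?_)
  rw [Real.norm_of_nonneg (sq_nonneg _)]
  simp only [Pi.add_apply]
  nlinarith [sq_nonneg (z.1 + z.2)]

lemma integrable_logReg_prod {ε : ℝ} (hε : 0 < ε) {μ ν : Measure ℝ} [IsFiniteMeasure μ]
    [IsFiniteMeasure ν] (hμ : Integrable (fun x => x ^ 2) μ) (hν : Integrable (fun x => x ^ 2) ν) :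
    Integrable (fun z : ℝ × ℝ => logReg ε (z.1 - z.2)) (μ.prod ν) := by
  have h := (integrable_const (μ := μ.prod ν) |Real.log ε|).add
    ((integrable_sub_sq_prod hμ hν).div_const (ε ^ 2))
  refine h.mono' ?_ (ae_of_all _ fun z => abs_logReg_le hε _)
  exact ((continuous_logReg hε).comp (by fun_prop)).aestronglyMeasurable

lemma abs_pairEnergy_logReg_le {μ ν : Measure ℝ} [IsProbabilityMeasure μ] [IsProbabilityMeasure ν]
    (hμ : Integrable (fun x => x ^ 2) μ) (hν : Integrable (fun x => x ^ 2) ν) :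
    ∃ M : ℝ, ∀ R : ℝ, 0 < R → |pairEnergy (logReg R) μ ν| ≤ M / R ^ 2 := by
  have key : ∀ (μ ν : Measure ℝ) [IsProbabilityMeasure μ] [IsProbabilityMeasure ν],
      Integrable (fun x => x ^ 2) μ → Integrable (fun x => x ^ 2) ν → ∀ R : ℝ, 0 < R →
      |(∫ z, logReg R (z.1 - z.2) ∂(μ.prod ν)) - Real.log R| ≤
        (∫ z, (z.1 - z.2) ^ 2 ∂(μ.prod ν)) / R ^ 2 := by
    intro μ ν _ _ hμ hν R hR
    have e : (∫ z, logReg R (z.1 - z.2) ∂(μ.prod ν)) - Real.log R =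
        ∫ z, (logReg R (z.1 - z.2) - Real.log R) ∂(μ.prod ν) := by
      rw [integral_sub (integrable_logReg_prod hR hμ hν) (integrable_const _)]
      simp
    rw [e, ← integral_div, ← Real.norm_eq_abs]
    refine norm_integral_le_of_norm_le ((integrable_sub_sq_prod hμ hν).div_const _)
      (ae_of_all _ fun z => ?_)
    have hu : ∀ u : ℝ, |logReg R u - Real.log R| ≤ u ^ 2 / R ^ 2 := by
      intro u
      have h1 : u ^ 2 + R ^ 2 = R ^ 2 * (1 + u ^ 2 / R ^ 2) := by field_simp; ring
      have hq : 0 ≤ u ^ 2 / R ^ 2 := by positivity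
      rw [logReg, h1, Real.log_mul (by positivity) (by positivity), Real.log_pow]
      have h3 := Real.log_nonneg (by linarith : 1 ≤ 1 + u ^ 2 / R ^ 2)
      have h4 := Real.log_le_sub_one_of_pos (by linarith : 0 < 1 + u ^ 2 / R ^ 2)
      push_cast
      rw [abs_le]
      constructor <;> linarith
    exact hu _
  refine ⟨(∫ z, (z.1 - z.2) ^ 2 ∂(μ.prod μ)) + 2 * (∫ z, (z.1 - z.2) ^ 2 ∂(μ.prod ν))
    + ∫ z, (z.1 - z.2) ^ 2 ∂(ν.prod ν), fun R hR => ?_⟩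
  have h1 := abs_le.1 (key μ μ hμ hμ R hR)
  have h2 := abs_le.1 (key μ ν hμ hν R hR)
  have h3 := abs_le.1 (key ν ν hν hν R hR)
  rw [pairEnergy, add_div, add_div, mul_div_assoc, abs_le]
  constructor <;> linarith [h1.1, h1.2, h2.1, h2.2, h3.1, h3.2]

lemma le_pairEnergy_logReg_sub {μ ν : Measure ℝ} [IsProbabilityMeasure μ] [IsProbabilityMeasure ν]
    (hμ : Integrable (fun x => x ^ 2) μ) (hν : Integrable (fun x => x ^ 2) ν)
    {ε k h m R : ℝ} (hε : 0 < ε) (hε' : ε ≤ 1 / 2) (hR : 1 ≤ R) (hk : 0 ≤ k) (hh : 0 < h)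
    (hm0 : 0 ≤ m) (hm : ∀ s ∈ Ioc k (k + h), m ≤ ‖charFun μ s - charFun ν s‖ ^ 2) :
    h / 2 * Real.exp (-(k + h)) * m ≤ pairEnergy (logReg R) μ ν - pairEnergy (logReg ε) μ ν := by
  have hεR : ε ≤ R := by linarith
  obtain ⟨i1, e1⟩ := integral_logReg_sub_prod hε hεR μ μ
  obtain ⟨i2, e2⟩ := integral_logReg_sub_prod hε hεR μ ν
  obtain ⟨i3, e3⟩ := integral_logReg_sub_prod hε hεR ν ν
  have hR0 : 0 < R := by linarith
  rw [integral_sub (integrable_logReg_prod hR0 hμ hμ) (integrable_logReg_prod hε hμ hμ)] at e1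
  rw [integral_sub (integrable_logReg_prod hR0 hμ hν) (integrable_logReg_prod hε hμ hν)] at e2
  rw [integral_sub (integrable_logReg_prod hR0 hν hν) (integrable_logReg_prod hε hν hν)] at e3
  set ρ := (volume.restrict (Ioc ε R)).prod (volume.restrict (Ioi (0 : ℝ))) with hρ
  have hF : (fun p : ℝ × ℝ => Real.exp (-(p.1 * p.2)) * ‖charFun μ p.2 - charFun ν p.2‖ ^ 2) =
      fun p : ℝ × ℝ =>
        Real.exp (-(p.1 * p.2)) * (∫ z, Real.cos (p.2 * (z.1 - z.2)) ∂(μ.prod μ))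
        - 2 * (Real.exp (-(p.1 * p.2)) * ∫ z, Real.cos (p.2 * (z.1 - z.2)) ∂(μ.prod ν))
        + Real.exp (-(p.1 * p.2)) * ∫ z, Real.cos (p.2 * (z.1 - z.2)) ∂(ν.prod ν) := by
    ext p
    rw [← pairEnergy_cos, pairEnergy]
    ring
  have hi : Integrable (fun p : ℝ × ℝ =>
      Real.exp (-(p.1 * p.2)) * ‖charFun μ p.2 - charFun ν p.2‖ ^ 2) ρ := by
    rw [hF]
    exact (i1.sub (i2.const_mul 2)).add i3
  have heq : pairEnergy (logReg R) μ ν - pairEnergy (logReg ε) μ ν =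
      ∫ p : ℝ × ℝ, Real.exp (-(p.1 * p.2)) * ‖charFun μ p.2 - charFun ν p.2‖ ^ 2 ∂ρ := by
    have i12 : Integrable (fun p : ℝ × ℝ =>
        Real.exp (-(p.1 * p.2)) * (∫ z, Real.cos (p.2 * (z.1 - z.2)) ∂(μ.prod μ))
        - 2 * (Real.exp (-(p.1 * p.2)) * ∫ z, Real.cos (p.2 * (z.1 - z.2)) ∂(μ.prod ν))) ρ :=
      i1.sub (i2.const_mul 2)
    rw [hF, integral_add i12 i3, integral_sub i1 (i2.const_mul 2), integral_const_mul, ← e1, ← e2,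
      ← e3, pairEnergy, pairEnergy]
    ring
  rw [heq]
  have hsub : Ioc (1 / 2 : ℝ) 1 ×ˢ Ioc k (k + h) ⊆ Ioc ε R ×ˢ Ioi (0 : ℝ) := by
    refine Set.prod_mono (Ioc_subset_Ioc hε' hR) fun x hx => ?_
    exact hk.trans_lt hx.1
  have hρ' : ρ = (volume : Measure (ℝ × ℝ)).restrict (Ioc ε R ×ˢ Ioi (0 : ℝ)) := by
    rw [hρ, Measure.prod_restrict, Measure.volume_eq_prod]
  rw [hρ'] at hi ⊢
  have h1 : ∫ p in Ioc (1 / 2 : ℝ) 1 ×ˢ Ioc k (k + h),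
      Real.exp (-(p.1 * p.2)) * ‖charFun μ p.2 - charFun ν p.2‖ ^ 2 ≤
      ∫ p in Ioc ε R ×ˢ Ioi (0 : ℝ),
      Real.exp (-(p.1 * p.2)) * ‖charFun μ p.2 - charFun ν p.2‖ ^ 2 :=
    setIntegral_mono_set hi (ae_of_all _ fun p => by positivity) hsub.eventuallyLE
  refine le_trans ?_ h1
  have hms : MeasurableSet (Ioc (1 / 2 : ℝ) 1 ×ˢ Ioc k (k + h)) :=
    measurableSet_Ioc.prod measurableSet_Ioc
  have hvol : (volume : Measure (ℝ × ℝ)) (Ioc (1 / 2 : ℝ) 1 ×ˢ Ioc k (k + h)) =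
      ENNReal.ofReal (1 / 2) * ENNReal.ofReal h := by
    rw [Measure.volume_eq_prod, Measure.prod_prod, Real.volume_Ioc, Real.volume_Ioc]
    norm_num
  have h2 : ∫ _ in Ioc (1 / 2 : ℝ) 1 ×ˢ Ioc k (k + h), Real.exp (-(k + h)) * m ≤
      ∫ p in Ioc (1 / 2 : ℝ) 1 ×ˢ Ioc k (k + h),
      Real.exp (-(p.1 * p.2)) * ‖charFun μ p.2 - charFun ν p.2‖ ^ 2 := by
    refine setIntegral_mono_on ?_ (hi.mono_measure (Measure.restrict_mono_set _ hsub)) hms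
      fun p hp => ?_
    · refine integrableOn_const ?_
      rw [hvol]
      exact ENNReal.mul_ne_top ENNReal.ofReal_ne_top ENNReal.ofReal_ne_top
    · have a1 : 1 / 2 < p.1 := hp.1.1
      have a2 : p.1 ≤ 1 := hp.1.2
      have a3 : k < p.2 := hp.2.1
      have a4 : p.2 ≤ k + h := hp.2.2
      refine mul_le_mul (Real.exp_le_exp.2 ?_) (hm p.2 hp.2) hm0 (Real.exp_pos _).le
      nlinarith
  refine le_trans (le_of_eq ?_) h2
  rw [setIntegral_const, measureReal_def, hvol, ENNReal.toReal_mul,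
    ENNReal.toReal_ofReal (by norm_num), ENNReal.toReal_ofReal hh.le, smul_eq_mul]
  ring

/-- The smoothed logarithmic energy of a difference of two probability measures controls the
difference of their characteristic functions. -/
theorem le_neg_pairEnergy_logReg {μ ν : Measure ℝ} [IsProbabilityMeasure μ] [IsProbabilityMeasure ν]
    (hμ : Integrable (fun x => x ^ 2) μ) (hν : Integrable (fun x => x ^ 2) ν)
    {ε k h m : ℝ} (hε : 0 < ε) (hε' : ε ≤ 1 / 2) (hk : 0 ≤ k) (hh : 0 < h)
    (hm0 : 0 ≤ m) (hm : ∀ s ∈ Ioc k (k + h), m ≤ ‖charFun μ s - charFun ν s‖ ^ 2) :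
    h / 2 * Real.exp (-(k + h)) * m ≤ -pairEnergy (logReg ε) μ ν := by
  obtain ⟨M, hM⟩ := abs_pairEnergy_logReg_le hμ hν
  have hlim : Tendsto (fun R : ℝ => M / R ^ 2 - pairEnergy (logReg ε) μ ν) atTop
      (𝓝 (0 - pairEnergy (logReg ε) μ ν)) :=
    (tendsto_const_nhds.div_atTop (tendsto_pow_atTop (α := ℝ) two_ne_zero)).sub_const _
  rw [zero_sub] at hlim
  refine ge_of_tendsto hlim ?_
  filter_upwards [eventually_ge_atTop 1] with R hR
  have h1 := le_pairEnergy_logReg_sub hμ hν hε hε' hR hk hh hm0 hm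
  have h2 := (abs_le.1 (hM R (by linarith))).2
  linarith

/-- The logarithmic potential of a measure. -/
noncomputable def logPot (ν : Measure ℝ) (x : ℝ) : ℝ := ∫ y, Real.log (x - y) ∂ν

/-- The effective potential created by the external field and by `ν`. -/
noncomputable def effPot (ν : Measure ℝ) (α x : ℝ) : ℝ :=
  x ^ 2 - 2 * α * Real.log x - 2 * logPot ν x

/-- `ν` satisfies the Euler–Lagrange conditions on `[σ, ∞)` with support in `[a, b]`, together
with quantitative regularity. -/
structure IsEquilibrium (ν : Measure ℝ) (α σ a b ℓ C : ℝ) : Prop where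
  prob : IsProbabilityMeasure ν
  supp : ∀ᵐ y ∂ν, y ∈ Icc a b
  integrable_log : ∀ x, Integrable (fun y => Real.log (x - y)) ν
  reg : ∀ x ε, 0 < ε → ε ≤ 1 →
    ∫ y, logReg ε (x - y) ∂ν ≤ logPot ν x + C * ε ^ (1 / 4 : ℝ)
  eq_const : ∀ x ∈ Icc a b, effPot ν α x = ℓ
  const_le : ∀ x, σ ≤ x → ℓ ≤ effPot ν α x
  density : ∃ f L : ℝ → ℝ, Measurable f ∧ (∀ y, 0 ≤ f y) ∧ Integrable L ν ∧
    ν = volume.withDensity (fun y => ENNReal.ofReal (f y)) ∧ ∀ y, f y ≤ Real.exp (L y)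

/-- The empirical measure of a configuration. -/
noncomputable def empMeasure {n : ℕ} (x : Fin n → ℝ) : Measure ℝ :=
  (n : ENNReal)⁻¹ • ∑ i, Measure.dirac (x i)

lemma isProbabilityMeasure_empMeasure {n : ℕ} (hn : n ≠ 0) (x : Fin n → ℝ) :
    IsProbabilityMeasure (empMeasure x) := by
  constructor
  simp [empMeasure, ENNReal.inv_mul_cancel, hn]

lemma integrable_empMeasure {n : ℕ} (hn : n ≠ 0) {E : Type*} [NormedAddCommGroup E]
    (x : Fin n → ℝ) (g : ℝ → E) : Integrable g (empMeasure x) := by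
  refine Integrable.smul_measure ?_ (by simp [hn])
  exact integrable_finsetSum_measure.2 fun i _ => integrable_dirac (by simp)

lemma integral_empMeasure {n : ℕ} {E : Type*} [NormedAddCommGroup E] [NormedSpace ℝ E]
    [CompleteSpace E]
    (x : Fin n → ℝ) (g : ℝ → E) :
    ∫ y, g y ∂(empMeasure x) = (n : ℝ)⁻¹ • ∑ i, g (x i) := by
  rw [empMeasure, integral_smul_measure,
    integral_finsetSum_measure fun i _ => integrable_dirac (by simp)]
  simp

lemma pairEnergy_empMeasure {n : ℕ} (hn : n ≠ 0) {ν : Measure ℝ} [IsProbabilityMeasure ν]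
    (hν : Integrable (fun x => x ^ 2) ν) (x : Fin n → ℝ) {ε : ℝ} (hε : 0 < ε) :
    (n : ℝ) ^ 2 * pairEnergy (logReg ε) (empMeasure x) ν =
      ∑ i, ∑ j, logReg ε (x i - x j) - 2 * n * ∑ i, ∫ y, logReg ε (x i - y) ∂ν
        + n ^ 2 * ∫ z, ∫ y, logReg ε (z - y) ∂ν ∂ν := by
  have := isProbabilityMeasure_empMeasure hn x
  have hL : Integrable (fun y : ℝ => y ^ 2) (empMeasure x) := integrable_empMeasure hn x _
  rw [pairEnergy, integral_prod _ (integrable_logReg_prod hε hL hL),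
    integral_prod _ (integrable_logReg_prod hε hL hν),
    integral_prod _ (integrable_logReg_prod hε hν hν)]
  simp only [integral_empMeasure, smul_eq_mul, ← Finset.mul_sum]
  have : (n : ℝ) ≠ 0 := by exact_mod_cast hn
  field_simp

lemma log_le_logReg {u : ℝ} (hu : u ≠ 0) (ε : ℝ) : Real.log u ≤ logReg ε u := by
  have h1 : Real.log u = Real.log (u ^ 2) / 2 := by rw [Real.log_pow]; push_cast; ring
  rw [h1, logReg]
  have : 0 < u ^ 2 := by positivity
  gcongr
  nlinarith [sq_nonneg ε]

lemma abs_rpow_le_exp_logReg {β : ℝ} (hβ : 0 < β) (u : ℝ) {ε : ℝ} :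
    |u| ^ β ≤ Real.exp (β * logReg ε u) := by
  rcases eq_or_ne u 0 with rfl | hu
  · rw [abs_zero, Real.zero_rpow hβ.ne']
    exact (Real.exp_pos _).le
  · rw [Real.rpow_def_of_pos (abs_pos.2 hu), Real.log_abs, mul_comm]
    gcongr
    exact log_le_logReg hu ε

lemma sum_sum_eq_of_symm {n : ℕ} (K : Fin n → Fin n → ℝ) (hK : ∀ i j, K i j = K j i) :
    ∑ i, ∑ j, K i j = ∑ i, K i i + 2 * ∑ i, ∑ j ∈ Finset.Ioi i, K i j := by
  have h1 : ∀ i, ∑ j, K i j = K i i + (∑ j ∈ Finset.Ioi i, K i j + ∑ j ∈ Finset.Iio i, K i j) := by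
    intro i
    rw [← Finset.sum_union, ← Finset.sum_erase_add _ _ (Finset.mem_univ i), add_comm]
    · congr 1
      refine Finset.sum_congr ?_ fun _ _ => rfl
      ext j
      simp only [Finset.mem_erase, Finset.mem_univ, and_true, Finset.mem_union, Finset.mem_Ioi,
        Finset.mem_Iio, ne_iff_lt_or_gt]
      tauto
    · exact Finset.disjoint_left.2 fun j hj hj' => by
        simp only [Finset.mem_Ioi, Finset.mem_Iio] at hj hj'
        exact lt_asymm hj hj'
  have h2 : ∑ i, ∑ j ∈ Finset.Iio i, K i j = ∑ i, ∑ j ∈ Finset.Ioi i, K i j := by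
    rw [Finset.sum_comm' (t' := Finset.univ) (s' := fun j => Finset.Ioi j) (by simp)]
    exact Finset.sum_congr rfl fun i _ => Finset.sum_congr rfl fun j _ => hK _ _
  simp only [h1, Finset.sum_add_distrib, h2]
  ring

lemma logReg_neg (ε u : ℝ) : logReg ε (-u) = logReg ε u := by simp [logReg]

lemma logReg_zero {ε : ℝ} : logReg ε 0 = Real.log ε := by
  simp [logReg]

/-- An upper bound for the eigenvalue density by a smoothed Gibbs weight. -/
lemma eigDens_le_exp_logReg {β : ℝ} (hβ : 0 < β) (μn : ℝ) {n : ℕ} {x : Fin n → ℝ}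
    (hx : ∀ i, 0 < x i) (ε : ℝ) :
    eigDens β μn n x ≤ Real.exp (-(β / 2) * (n * ∑ i, x i ^ 2 - 2 * μn * ∑ i, Real.log (x i)
      - ∑ i, ∑ j, logReg ε (x i - x j) + n * Real.log ε)) := by
  have h1 : ∏ i, x i ^ (β * μn) = Real.exp (β * μn * ∑ i, Real.log (x i)) := by
    rw [Finset.mul_sum, Real.exp_sum]
    refine Finset.prod_congr rfl fun i _ => ?_
    rw [Real.rpow_def_of_pos (hx i), mul_comm]
  have h2 : ∏ i, ∏ j ∈ Finset.Ioi i, |x i - x j| ^ β ≤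
      Real.exp (β * ∑ i, ∑ j ∈ Finset.Ioi i, logReg ε (x i - x j)) := by
    simp only [Finset.mul_sum, Real.exp_sum]
    refine Finset.prod_le_prod (fun i _ => Finset.prod_nonneg fun j _ => by positivity) fun i _ =>
      Finset.prod_le_prod (fun j _ => by positivity) fun j _ => abs_rpow_le_exp_logReg hβ _
  have h3 := sum_sum_eq_of_symm (fun i j => logReg ε (x i - x j)) fun i j => by
    rw [← logReg_neg, neg_sub]
  simp only [sub_self, logReg_zero, Finset.sum_const, Finset.card_univ, Fintype.card_fin,
    nsmul_eq_mul] at h3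
  rw [eigDens, h1, h3]
  refine (mul_le_mul_of_nonneg_left h2 (by positivity)).trans (le_of_eq ?_)
  rw [← Real.exp_add, ← Real.exp_add]
  congr 1
  ring

lemma IsEquilibrium.nullSingletonClass {ν : Measure ℝ} {α σ a b ℓ C : ℝ}
    (h : IsEquilibrium ν α σ a b ℓ C) : NullSingletonClass ν := by
  obtain ⟨f, L, -, -, -, hν, -⟩ := h.density
  rw [hν]
  infer_instance

lemma IsEquilibrium.integrable_of_continuous {ν : Measure ℝ} {α σ a b ℓ C : ℝ}
    (h : IsEquilibrium ν α σ a b ℓ C) {g : ℝ → ℝ} (hg : Continuous g) : Integrable g ν := by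
  have := h.prob
  obtain ⟨M, hM⟩ := isCompact_Icc.exists_bound_of_continuousOn (s := Icc a b) hg.continuousOn
  refine (integrable_const M).mono' hg.aestronglyMeasurable ?_
  filter_upwards [h.supp] with y hy using hM y hy

lemma IsEquilibrium.logPot_le_integral_logReg {ν : Measure ℝ} {α σ a b ℓ C : ℝ}
    (h : IsEquilibrium ν α σ a b ℓ C) (x : ℝ) {ε : ℝ} (hε : 0 < ε) :
    logPot ν x ≤ ∫ y, logReg ε (x - y) ∂ν := by
  have := h.nullSingletonClass
  refine integral_mono_ae (h.integrable_log x)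
    (h.integrable_of_continuous ((continuous_logReg hε).comp (by fun_prop))) ?_
  filter_upwards [ν.ae_ne x] with y hy
  exact log_le_logReg (sub_ne_zero.2 hy.symm) ε

lemma IsEquilibrium.logPot_le {ν : Measure ℝ} {α σ a b ℓ C : ℝ}
    (h : IsEquilibrium ν α σ a b ℓ C) (ha : 0 < a) {x : ℝ} (hx : 0 < x) :
    logPot ν x ≤ x + b := by
  have := h.prob
  have h1 : logPot ν x ≤ ∫ _, (x + b) ∂ν := by
    refine integral_mono_ae (h.integrable_log x) (integrable_const _) ?_
    filter_upwards [h.supp] with y hy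
    have h2 := Real.log_le_self (abs_nonneg (x - y))
    rw [Real.log_abs] at h2
    refine h2.trans (abs_le.2 ⟨?_, ?_⟩) <;> linarith [hy.1, hy.2]
  simpa using h1

lemma IsEquilibrium.effPot_growth {ν : Measure ℝ} {α σ a b ℓ C : ℝ}
    (h : IsEquilibrium ν α σ a b ℓ C) (ha : 0 < a) (hα : 0 < α) :
    ∃ c, 0 ≤ c ∧ ∀ x, 0 < x → x ^ 2 / 2 - c ≤ effPot ν α x - ℓ := by
  refine ⟨|2 * (α + 1) ^ 2 + 2 * b + ℓ|, abs_nonneg _, fun x hx => ?_⟩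
  have h1 := h.logPot_le ha hx
  have h2 := Real.log_le_self hx.le
  have h3 := le_abs_self (2 * (α + 1) ^ 2 + 2 * b + ℓ)
  rw [effPot]
  nlinarith [sq_nonneg (x - 2 * (α + 1)), mul_le_mul_of_nonneg_left h2 hα.le]

lemma IsEquilibrium.integrable_logPot {ν : Measure ℝ} {α σ a b ℓ C : ℝ}
    (h : IsEquilibrium ν α σ a b ℓ C) (ha : 0 < a) : Integrable (logPot ν) ν := by
  have := h.prob
  have hc : ContinuousOn (fun x => (x ^ 2 - 2 * α * Real.log x - ℓ) / 2) (Icc a b) := by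
    refine ContinuousOn.div_const (ContinuousOn.sub (ContinuousOn.sub (by fun_prop)
      (ContinuousOn.mul continuousOn_const (Real.continuousOn_log.mono fun x hx => ?_)))
      continuousOn_const) _
    exact (ha.trans_le hx.1).ne'
  have h1 : IntegrableOn (fun x => (x ^ 2 - 2 * α * Real.log x - ℓ) / 2) (Icc a b) ν :=
    hc.integrableOn_compact isCompact_Icc
  rw [IntegrableOn, Measure.restrict_eq_self_of_ae_mem h.supp] at h1
  refine h1.congr ?_
  filter_upwards [h.supp] with x hx
  have := h.eq_const x hx
  rw [effPot] at this
  linarith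

lemma IsEquilibrium.integral_logPot_le {ν : Measure ℝ} {α σ a b ℓ C : ℝ}
    (h : IsEquilibrium ν α σ a b ℓ C) (ha : 0 < a) {ε : ℝ} (hε : 0 < ε) :
    ∫ x, logPot ν x ∂ν ≤ ∫ x, ∫ y, logReg ε (x - y) ∂ν ∂ν := by
  have := h.prob
  refine integral_mono (h.integrable_logPot ha) ?_ fun x => h.logPot_le_integral_logReg x hε
  have h2 : Integrable (fun x : ℝ => x ^ 2) ν := h.integrable_of_continuous (by fun_prop)
  exact (integrable_logReg_prod hε h2 h2).integral_prod_left

/-- Lower bound for the smoothed energy of a configuration in terms of the effective potential and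
of the distance of its empirical measure to `ν`. -/
lemma IsEquilibrium.energy_lower {ν : Measure ℝ} {α σ a b ℓ C : ℝ}
    (h : IsEquilibrium ν α σ a b ℓ C) (ha : 0 < a) {n : ℕ} (hn : n ≠ 0) (x : Fin n → ℝ)
    {ε : ℝ} (hε : 0 < ε) (hε' : ε ≤ 1) :
    n * ∑ i, (effPot ν α (x i) - ℓ) + n ^ 2 * (ℓ + ∫ x, logPot ν x ∂ν
        - pairEnergy (logReg ε) (empMeasure x) ν - 2 * C * ε ^ (1 / 4 : ℝ)) ≤
      n * ∑ i, x i ^ 2 - 2 * (α * n) * ∑ i, Real.log (x i) - ∑ i, ∑ j, logReg ε (x i - x j) := by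
  have := h.prob
  have h2 : Integrable (fun x : ℝ => x ^ 2) ν := h.integrable_of_continuous (by fun_prop)
  have e1 := pairEnergy_empMeasure hn h2 x hε
  have e2 : ∑ i, ∫ y, logReg ε (x i - y) ∂ν ≤ ∑ i, logPot ν (x i) + n * (C * ε ^ (1 / 4 : ℝ)) := by
    refine (Finset.sum_le_sum fun i _ => h.reg (x i) ε hε hε').trans (le_of_eq ?_)
    simp [Finset.sum_add_distrib]
  have e3 := h.integral_logPot_le ha hε
  have e4 : ∑ i, (effPot ν α (x i) - ℓ) = ∑ i, x i ^ 2 - 2 * α * ∑ i, Real.log (x i)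
      - 2 * ∑ i, logPot ν (x i) - n * ℓ := by
    simp [effPot, Finset.sum_sub_distrib, Finset.mul_sum]
  have hn0 : (0 : ℝ) ≤ n := Nat.cast_nonneg n
  have e5 := mul_le_mul_of_nonneg_left e2 (by positivity : (0 : ℝ) ≤ 2 * n)
  have e6 := mul_le_mul_of_nonneg_left e3 (by positivity : (0 : ℝ) ≤ (n : ℝ) ^ 2)
  rw [e4]
  nlinarith

lemma norm_charFun_sub_le (μ : Measure ℝ) [IsProbabilityMeasure μ]
    (hμ : Integrable (fun x => |x|) μ) (s t : ℝ) :
    ‖charFun μ s - charFun μ t‖ ≤ |s - t| * ∫ x, |x| ∂μ := by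
  have hi : ∀ s : ℝ, Integrable (fun x : ℝ => Complex.exp (s * x * Complex.I)) μ := fun s => by
    refine (integrable_const (1 : ℝ)).mono' (by fun_prop) (ae_of_all _ fun x => ?_)
    rw [← Complex.ofReal_mul, Complex.norm_exp_ofReal_mul_I]
  rw [charFun_apply_real, charFun_apply_real, ← integral_sub (hi s) (hi t), ← integral_const_mul]
  refine norm_integral_le_of_norm_le (hμ.const_mul _) (ae_of_all _ fun x => ?_)
  have h1 : Complex.exp (s * x * Complex.I) - Complex.exp (t * x * Complex.I) =
      Complex.exp (t * x * Complex.I) * (Complex.exp (Complex.I * ((s - t) * x : ℝ)) - 1) := by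
    rw [mul_sub, ← Complex.exp_add, mul_one]
    congr 2
    push_cast
    ring
  rw [h1, norm_mul, ← Complex.ofReal_mul, Complex.norm_exp_ofReal_mul_I, one_mul, ← abs_mul]
  exact Real.norm_exp_I_mul_ofReal_sub_one_le

/-- The squared distance of characteristic functions at neighbouring points. -/
lemma norm_charFun_sub_sq_ge {μ ν : Measure ℝ} [IsProbabilityMeasure μ] [IsProbabilityMeasure ν]
    (hμ : Integrable (fun x => |x|) μ) (hν : Integrable (fun x => |x|) ν) {k h s : ℝ}
    (hs : s ∈ Ioc k (k + h)) :
    ‖charFun μ k - charFun ν k‖ ^ 2 / 2 - h ^ 2 * (∫ x, |x| ∂μ + ∫ x, |x| ∂ν) ^ 2 ≤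
      ‖charFun μ s - charFun ν s‖ ^ 2 := by
  have h1 := norm_charFun_sub_le μ hμ k s
  have h2 := norm_charFun_sub_le ν hν k s
  have hks : |k - s| ≤ h := abs_le.2 ⟨by linarith [hs.2], by linarith [hs.1, hs.2]⟩
  have p1 : 0 ≤ ∫ x, |x| ∂μ := integral_nonneg fun _ => abs_nonneg _
  have p2 : 0 ≤ ∫ x, |x| ∂ν := integral_nonneg fun _ => abs_nonneg _
  set M := ∫ x, |x| ∂μ + ∫ x, |x| ∂ν
  have h3 : ‖charFun μ k - charFun ν k‖ ≤ ‖charFun μ s - charFun ν s‖ + h * M := by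
    have e : charFun μ k - charFun ν k = (charFun μ s - charFun ν s) +
      ((charFun μ k - charFun μ s) - (charFun ν k - charFun ν s)) := by ring
    rw [e]
    refine (norm_add_le _ _).trans (add_le_add le_rfl ((norm_sub_le _ _).trans ?_))
    have := mul_le_mul_of_nonneg_right hks (add_nonneg p1 p2)
    linarith
  have h4 : ‖charFun μ k - charFun ν k‖ ^ 2 ≤ (‖charFun μ s - charFun ν s‖ + h * M) ^ 2 :=
    pow_le_pow_left₀ (norm_nonneg _) h3 2
  nlinarith [sq_nonneg (‖charFun μ s - charFun ν s‖ - h * M)]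

lemma abs_log_le {σ x : ℝ} (hσ : 0 < σ) (hx : σ ≤ x) : |Real.log x| ≤ x ^ 2 + (1 + 1 / σ) := by
  have hx0 : 0 < x := hσ.trans_le hx
  have h1 := Real.log_le_self hx0.le
  have h2 := Real.log_le_self (inv_pos.2 hx0).le
  rw [Real.log_inv] at h2
  have h3 : x⁻¹ ≤ 1 / σ := by rw [inv_eq_one_div]; exact one_div_le_one_div_of_le hσ hx
  have h4 : 0 < 1 / σ := by positivity
  rw [abs_le]
  constructor <;> nlinarith [sq_nonneg (x - 1)]

lemma neg_pairEnergy_empMeasure_ge {ν : Measure ℝ} [IsProbabilityMeasure ν]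
    (hν2 : Integrable (fun x => x ^ 2) ν) (hν1 : Integrable (fun x => |x|) ν)
    {n : ℕ} (hn : n ≠ 0) (x : Fin n → ℝ) {ε k η : ℝ} (hε : 0 < ε) (hε' : ε ≤ 1 / 2) (hk : 0 ≤ k)
    (hη : 0 < η) (hη' : η ≤ 1) :
    Real.exp (-(k + 1)) / 4 * η * ‖charFun (empMeasure x) k - charFun ν k‖ ^ 2
      - η ^ 3 * ((n : ℝ)⁻¹ * ∑ i, x i ^ 2 + (∫ y, |y| ∂ν) ^ 2) ≤
      -pairEnergy (logReg ε) (empMeasure x) ν := by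
  have := isProbabilityMeasure_empMeasure hn x
  have hL : ∀ g : ℝ → ℝ, Integrable g (empMeasure x) := fun g => integrable_empMeasure hn x g
  set D := ‖charFun (empMeasure x) k - charFun ν k‖ ^ 2
  set B := ∫ y, |y| ∂ν
  have hn0 : (0 : ℝ) < n := by exact_mod_cast Nat.pos_of_ne_zero hn
  have hmean : (∫ y, |y| ∂(empMeasure x)) ^ 2 ≤ (n : ℝ)⁻¹ * ∑ i, x i ^ 2 := by
    rw [integral_empMeasure, smul_eq_mul, mul_pow]
    have h1 := sq_sum_le_card_mul_sum_sq (s := Finset.univ) (f := fun i => |x i|)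
    simp only [sq_abs, Finset.card_univ, Fintype.card_fin] at h1
    calc ((n : ℝ)⁻¹) ^ 2 * (∑ i, |x i|) ^ 2 ≤ ((n : ℝ)⁻¹) ^ 2 * (n * ∑ i, x i ^ 2) := by gcongr
      _ = (n : ℝ)⁻¹ * ∑ i, x i ^ 2 := by field_simp
  set M := ∫ y, |y| ∂(empMeasure x) + B
  have hM : M ^ 2 ≤ 2 * ((n : ℝ)⁻¹ * ∑ i, x i ^ 2) + 2 * B ^ 2 := by
    nlinarith [sq_nonneg ((∫ y, |y| ∂(empMeasure x)) - B)]
  have key := le_neg_pairEnergy_logReg (hL _) hν2 (m := max 0 (D / 2 - η ^ 2 * M ^ 2)) hε hε' hk hη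
    (le_max_left _ _) fun s hs => max_le (by positivity) (norm_charFun_sub_sq_ge (hL _) hν1 hs)
  refine le_trans ?_ key
  have hexp : Real.exp (-(k + 1)) ≤ Real.exp (-(k + η)) := Real.exp_le_exp.2 (by linarith)
  have hexp1 : Real.exp (-(k + 1)) ≤ 1 := Real.exp_le_one_iff.2 (by linarith)
  have h1 : η / 2 * Real.exp (-(k + 1)) * (D / 2 - η ^ 2 * M ^ 2) ≤
      η / 2 * Real.exp (-(k + η)) * max 0 (D / 2 - η ^ 2 * M ^ 2) :=
    (mul_le_mul_of_nonneg_left (le_max_right 0 _) (by positivity)).trans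
      (mul_le_mul_of_nonneg_right (by gcongr) (le_max_left _ _))
  refine le_trans ?_ h1
  have h2 : η ^ 3 / 2 * M ^ 2 * Real.exp (-(k + 1)) ≤ η ^ 3 / 2 * M ^ 2 * 1 := by gcongr
  have h3 : η ^ 3 / 2 * M ^ 2 ≤ η ^ 3 / 2 * (2 * ((n : ℝ)⁻¹ * ∑ i, x i ^ 2) + 2 * B ^ 2) := by
    gcongr
  nlinarith

/-- Pointwise upper bound for the eigenvalue density, with an exponential gain in the distance
between characteristic functions. -/
theorem IsEquilibrium.eigDens_upper {ν : Measure ℝ} {α σ a b ℓ C β : ℝ} {μ : ℕ → ℝ}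
    (h : IsEquilibrium ν α σ a b ℓ C) (hβ : 0 < β) (hα : 0 < α) (hσ : 0 < σ) (hσa : σ ≤ a)
    (hμ : Tendsto (fun n : ℕ => μ n / n) atTop (𝓝 α)) {k : ℝ} (hk : 0 ≤ k) :
    ∃ κ > 0, ∃ C₁ c : ℝ, ∃ err : ℕ → ℝ, Tendsto err atTop (𝓝 0) ∧
      ∀ η, 0 < η → η ≤ 1 / 2 → ∀ᶠ n : ℕ in atTop, ∀ x : Fin n → ℝ, (∀ i, σ ≤ x i) →
        eigDens β (μ n) n x *
          Real.exp (β / 2 * n ^ 2 * (κ * η * ‖charFun (empMeasure x) k - charFun ν k‖ ^ 2)) ≤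
        Real.exp (-(β / 2) * n ^ 2 * (ℓ + ∫ y, logPot ν y ∂ν - C₁ * η ^ 3 - err n)) *
          ∏ i, Real.exp (-(β / 4) * (x i ^ 2 / 2 - c)) := by
  have := h.prob
  have ha : 0 < a := hσ.trans_le hσa
  obtain ⟨c, hc0, hc⟩ := h.effPot_growth ha hα
  have hν2 : Integrable (fun x : ℝ => x ^ 2) ν := h.integrable_of_continuous (by fun_prop)
  have hν1 : Integrable (fun x : ℝ => |x|) ν := h.integrable_of_continuous (by fun_prop)
  set B := ∫ y, |y| ∂ν with hB
  set c₂ := 2 * c + (1 + 1 / σ) with hc₂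
  have hδ : Tendsto (fun n : ℕ => |μ n / n - α|) atTop (𝓝 0) := by
    have := (hμ.sub_const α).abs
    simpa using this
  have hlog : Tendsto (fun n : ℕ => Real.log n / n) atTop (𝓝 0) := by
    have := (Real.isLittleO_log_id_atTop.tendsto_div_nhds_zero).comp tendsto_natCast_atTop_atTop
    exact this
  have hpow : Tendsto (fun n : ℕ => ((1 : ℝ) / n) ^ (1 / 4 : ℝ)) atTop (𝓝 0) := by
    have h0 : Tendsto (fun n : ℕ => (1 : ℝ) / n) atTop (𝓝 0) := tendsto_one_div_atTop_nhds_zero_nat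
    have := h0.rpow_const (p := (1 / 4 : ℝ)) (Or.inr (by norm_num))
    rwa [Real.zero_rpow (by norm_num)] at this
  refine ⟨Real.exp (-(k + 1)) / 4, by positivity, 2 * c + B ^ 2, c,
    fun n => 2 * C * ((1 : ℝ) / n) ^ (1 / 4 : ℝ) + Real.log n / n + 2 * c₂ * |μ n / n - α|, ?_, ?_⟩
  · simpa using ((hpow.const_mul (2 * C)).add hlog).add (hδ.const_mul (2 * c₂))
  intro η hη hη'
  filter_upwards [eventually_ge_atTop 2, hδ.eventually (eventually_le_nhds (by norm_num :
    (0 : ℝ) < 1 / 16))] with n hn hδn x hx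
  have hn2 : (2 : ℝ) ≤ n := by exact_mod_cast hn
  have hn0 : (0 : ℝ) < n := by linarith
  have hne : n ≠ 0 := by omega
  have hε : (0 : ℝ) < 1 / n := by positivity
  have hε' : (1 : ℝ) / n ≤ 1 / 2 := one_div_le_one_div_of_le (by norm_num) hn2
  have hx0 : ∀ i, 0 < x i := fun i => hσ.trans_le (hx i)
  have e1 := eigDens_le_exp_logReg hβ (μ n) hx0 (1 / n)
  have e2 := h.energy_lower ha hne x hε (by linarith)
  have e3 := neg_pairEnergy_empMeasure_ge hν2 hν1 hne x hε hε' hk hη (by linarith)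
  set D := ‖charFun (empMeasure x) k - charFun ν k‖ ^ 2
  set A := pairEnergy (logReg (1 / n)) (empMeasure x) ν
  set S := ∑ i, (effPot ν α (x i) - ℓ) with hS
  have s0 : ∑ i, (x i ^ 2 / 2 - c) ≤ S := Finset.sum_le_sum fun i _ => hc _ (hx0 i)
  have s1 : ∑ i, x i ^ 2 ≤ 2 * S + 2 * c * n := by
    have : ∑ i, (x i ^ 2 / 2 - c) = (∑ i, x i ^ 2) / 2 - n * c := by
      simp [Finset.sum_sub_distrib, Finset.sum_div]
    linarith
  have s2 : |∑ i, Real.log (x i)| ≤ 2 * S + c₂ * n := by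
    refine (Finset.abs_sum_le_sum_abs _ _).trans ?_
    refine (Finset.sum_le_sum fun i _ => abs_log_le hσ (hx i)).trans ?_
    simp only [Finset.sum_add_distrib, Finset.sum_const, Finset.card_univ, Fintype.card_fin,
      nsmul_eq_mul]
    rw [hc₂]
    nlinarith
  have s3 : 0 ≤ S := Finset.sum_nonneg fun i _ => sub_nonneg.2 (h.const_le _ (hx i))
  set δ := |μ n / n - α| with hδ'
  have s4 : 2 * (μ n - α * n) * ∑ i, Real.log (x i) ≤ 2 * n * δ * (2 * S + c₂ * n) := by
    have : μ n - α * n = n * (μ n / n - α) := by field_simp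
    rw [this]
    calc 2 * (n * (μ n / n - α)) * ∑ i, Real.log (x i)
        ≤ |2 * (n * (μ n / n - α)) * ∑ i, Real.log (x i)| := le_abs_self _
      _ = 2 * n * δ * |∑ i, Real.log (x i)| := by
        rw [abs_mul, abs_mul, abs_mul, abs_of_pos hn0, abs_two]; ring
      _ ≤ _ := by gcongr
  have s5 : 2 * n * δ * (2 * S) ≤ n * S / 4 := by
    have : n * S * δ ≤ n * S * (1 / 16) := by gcongr
    linarith
  have s6 : (n : ℝ) ^ 2 * (η ^ 3 * ((n : ℝ)⁻¹ * ∑ i, x i ^ 2)) ≤ n * S / 4 +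
      n ^ 2 * (η ^ 3 * (2 * c)) := by
    have e : (n : ℝ) ^ 2 * (η ^ 3 * ((n : ℝ)⁻¹ * ∑ i, x i ^ 2)) = n * η ^ 3 * ∑ i, x i ^ 2 := by
      field_simp
    rw [e]
    have h3 : η ^ 3 ≤ (1 / 2) ^ 3 := by gcongr
    have h4 : n * S * η ^ 3 ≤ n * S * (1 / 2) ^ 3 := by gcongr
    calc n * η ^ 3 * ∑ i, x i ^ 2 ≤ n * η ^ 3 * (2 * S + 2 * c * n) := by gcongr
      _ ≤ _ := by linarith
  have s7 : (n : ℝ) ^ 2 * (Real.log n / n) = -(n * Real.log (1 / n)) := by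
    rw [one_div, Real.log_inv]
    field_simp
  have s8 : ∑ i, (x i ^ 2 / 2 - c) ≤ n * S := s0.trans (by nlinarith)
  have s9 := mul_le_mul_of_nonneg_left e3 (by positivity : (0 : ℝ) ≤ (n : ℝ) ^ 2)
  rw [← Real.exp_sum, ← Finset.mul_sum, ← Real.exp_add]
  refine (mul_le_mul_of_nonneg_right e1 (Real.exp_pos _).le).trans ?_
  rw [← Real.exp_add, Real.exp_le_exp]
  set E := ∫ y, logPot ν y ∂ν
  set w := Real.exp (-(k + 1)) / 4
  have key : n ^ 2 * (w * η * D) + n ^ 2 * (ℓ + E - (2 * c + B ^ 2) * η ^ 3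
      - (2 * C * ((1 : ℝ) / n) ^ (1 / 4 : ℝ) + Real.log n / n + 2 * c₂ * δ))
      + 1 / 2 * ∑ i, (x i ^ 2 / 2 - c) ≤ n * ∑ i, x i ^ 2 - 2 * μ n * ∑ i, Real.log (x i)
      - ∑ i, ∑ j, logReg (1 / n) (x i - x j) + n * Real.log (1 / n) := by
    nlinarith
  have := mul_le_mul_of_nonneg_left key (by positivity : 0 ≤ β / 2)
  linarith

lemma pi_withDensity {n : ℕ} {f : ℝ → ℝ} (hf0 : ∀ y, 0 ≤ f y)
    (hfi : Integrable f) :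
    Measure.pi (fun _ : Fin n => volume.withDensity fun y => ENNReal.ofReal (f y)) =
      (volume : Measure (Fin n → ℝ)).withDensity fun x => ENNReal.ofReal (∏ i, f (x i)) := by
  have : IsFiniteMeasure (volume.withDensity fun y => ENNReal.ofReal (f y)) :=
    isFiniteMeasure_withDensity_ofReal hfi.2
  refine Measure.pi_eq fun s hs => ?_
  have hi : ∀ i, Integrable ((s i).indicator f) := fun i => hfi.indicator (hs i)
  have hi0 : ∀ i y, 0 ≤ (s i).indicator f y := fun i y => indicator_nonneg (fun z _ => hf0 z) y
  have h1 : ∀ x : Fin n → ℝ, (univ.pi s).indicator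
      (fun x => ENNReal.ofReal (∏ i, f (x i))) x =
      ENNReal.ofReal (∏ i, (s i).indicator f (x i)) := by
    intro x
    by_cases hx : x ∈ univ.pi s
    · rw [indicator_of_mem hx]
      congr 1
      exact Finset.prod_congr rfl fun i _ => by rw [indicator_of_mem (hx i (mem_univ i))]
    · rw [indicator_of_notMem hx]
      simp only [Set.mem_pi, mem_univ, true_imp_iff, not_forall] at hx
      obtain ⟨i, hi⟩ := hx
      rw [Finset.prod_eq_zero (Finset.mem_univ i) (indicator_of_notMem hi f), ENNReal.ofReal_zero]
  rw [withDensity_apply _ (MeasurableSet.univ_pi hs), ← lintegral_indicator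
    (MeasurableSet.univ_pi hs)]
  simp_rw [h1]
  rw [volume_pi, ← ofReal_integral_eq_lintegral_ofReal (Integrable.fintype_prod hi)
    (ae_of_all _ fun x => Finset.prod_nonneg fun i _ => hi0 i _),
    integral_fintype_prod_eq_prod, ENNReal.ofReal_prod_of_nonneg
    fun i _ => integral_nonneg (hi0 i)]
  refine Finset.prod_congr rfl fun i _ => ?_
  rw [ofReal_integral_eq_lintegral_ofReal (hi i) (ae_of_all _ (hi0 i)),
    withDensity_apply _ (hs i), ← lintegral_indicator (hs i)]
  refine lintegral_congr fun y => ?_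
  by_cases hy : y ∈ s i <;> simp [hy]

lemma measurePreserving_pair {n : ℕ} (ν : Measure ℝ) [IsProbabilityMeasure ν] {i j : Fin n}
    (hij : i ≠ j) :
    MeasurePreserving (fun x : Fin n → ℝ => (x i, x j)) (Measure.pi fun _ => ν) (ν.prod ν) := by
  refine ⟨by fun_prop, ?_⟩
  have h1 := (iIndepFun_pi (μ := fun _ : Fin n => ν) (X := fun _ => (id : ℝ → ℝ))
    fun _ => aemeasurable_id).indepFun hij
  have h2 := (indepFun_iff_map_prod_eq_prod_map_map (measurable_pi_apply i).aemeasurable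
    (measurable_pi_apply j).aemeasurable).1 h1
  refine h2.trans ?_
  congr 1 <;> exact (measurePreserving_eval _ _).map_eq

namespace IsEquilibrium

variable {ν : Measure ℝ} {α σ a b ℓ C : ℝ}

lemma integrable_log_prod (h : IsEquilibrium ν α σ a b ℓ C) (ha : 0 < a) :
    Integrable (fun z : ℝ × ℝ => Real.log (z.1 - z.2)) (ν.prod ν) := by
  have := h.prob
  have hm : AEStronglyMeasurable (fun z : ℝ × ℝ => Real.log (z.1 - z.2)) (ν.prod ν) :=
    (Real.measurable_log.comp (by fun_prop)).aestronglyMeasurable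
  refine (integrable_prod_iff hm).2 ⟨ae_of_all _ h.integrable_log, ?_⟩
  have hlin : Integrable (fun x : ℝ => x + b + 2 * |C|) ν :=
    h.integrable_of_continuous (by fun_prop)
  refine hlin.mono' hm.norm.integral_prod_right' ?_
  filter_upwards [h.supp] with x hx
  have hR : Integrable (fun y => logReg 1 (x - y)) ν :=
    h.integrable_of_continuous ((continuous_logReg one_pos).comp (by fun_prop))
  rw [Real.norm_of_nonneg (integral_nonneg fun _ => norm_nonneg _)]
  have hb : ∀ u : ℝ, |Real.log u| ≤ 2 * logReg 1 u - Real.log u := by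
    intro u
    have h0 : 0 ≤ logReg 1 u := by
      have : 0 ≤ Real.log (u ^ 2 + 1 ^ 2) := Real.log_nonneg (by nlinarith [sq_nonneg u])
      exact div_nonneg this two_pos.le
    rcases eq_or_ne u 0 with rfl | hu
    · simpa using h0
    · have := log_le_logReg hu 1
      rw [abs_le]; constructor <;> linarith
  calc ∫ y, ‖Real.log (x - y)‖ ∂ν ≤ ∫ y, (2 * logReg 1 (x - y) - Real.log (x - y)) ∂ν :=
        integral_mono (h.integrable_log x).norm ((hR.const_mul 2).sub (h.integrable_log x))
          fun y => hb _
    _ = 2 * ∫ y, logReg 1 (x - y) ∂ν - logPot ν x := by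
        rw [integral_sub (hR.const_mul 2) (h.integrable_log x), integral_const_mul, logPot]
    _ ≤ logPot ν x + 2 * |C| := by
        have := h.reg x 1 one_pos le_rfl
        rw [Real.one_rpow] at this
        linarith [le_abs_self C]
    _ ≤ x + b + 2 * |C| := by
        have := h.logPot_le ha (ha.trans_le hx.1)
        linarith

/-- Jensen's lower bound for the partition function. -/
lemma exists_exp_le_integral_eigDens (h : IsEquilibrium ν α σ a b ℓ C) (hσ : 0 < σ)
    (hσa : σ ≤ a) {β : ℝ} :
    ∃ Λ I : ℝ, ∀ (n : ℕ) (μn : ℝ), IntegrableOn (eigDens β μn n) {x | ∀ i, σ ≤ x i} →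
      Real.exp (-(β / 2) * (n ^ 2 * (ℓ + ∫ y, logPot ν y ∂ν) + n * ∫ y, logPot ν y ∂ν)
        + β * (μn - α * n) * n * Λ - n * I) ≤ ∫ x in {x | ∀ i, σ ≤ x i}, eigDens β μn n x := by
  have := h.prob
  have ha : 0 < a := hσ.trans_le hσa
  have hna := h.nullSingletonClass
  obtain ⟨f, L, hf, hf0, hL, hν, hfL⟩ := h.density
  have hlog : Integrable Real.log ν := by
    refine ((h.integrable_log 0).congr (ae_of_all _ fun y => ?_))
    simp
  have hsq : Integrable (fun y : ℝ => y ^ 2) ν := h.integrable_of_continuous (by fun_prop)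
  have hpot := h.integrable_logPot ha
  refine ⟨∫ y, Real.log y ∂ν, ∫ y, L y ∂ν, fun n μn hint => ?_⟩
  set E := ∫ y, logPot ν y ∂ν with hE
  set Λ := ∫ y, Real.log y ∂ν
  set I := ∫ y, L y ∂ν
  set S : Set (Fin n → ℝ) := {x | ∀ i, σ ≤ x i} with hS
  have hSm : MeasurableSet S := by
    rw [hS, ofPred_forall]
    exact MeasurableSet.iInter fun i => measurableSet_le measurable_const (measurable_pi_apply i)
  set m := -(β / 2) * (n ^ 2 * (ℓ + E) + n * E) + β * (μn - α * n) * n * Λ - n * I with hm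
  have hsq_int : ∫ y, y ^ 2 ∂ν = ℓ + 2 * E + 2 * α * Λ := by
    have h1 : ∫ y, effPot ν α y ∂ν = ℓ := by
      rw [integral_congr_ae (g := fun _ => ℓ) (h.supp.mono fun y hy => h.eq_const y hy)]
      simp
    simp only [effPot] at h1
    rw [integral_sub (show Integrable (fun y => y ^ 2 - 2 * α * Real.log y) ν from
      hsq.sub (hlog.const_mul _)) (hpot.const_mul _),
      integral_sub hsq (hlog.const_mul _), integral_const_mul, integral_const_mul] at h1
    linarith
  set π : Measure (Fin n → ℝ) := Measure.pi fun _ => ν with hπ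
  set u : (Fin n → ℝ) → ℝ := fun x => -(n * β / 2) * ∑ i, x i ^ 2 + β * μn * ∑ i, Real.log (x i)
    + β * ∑ i, ∑ j ∈ Finset.Ioi i, Real.log (x i - x j) - ∑ i, L (x i) with hu
  have hi1 : ∀ i, Integrable (fun x : Fin n → ℝ => x i ^ 2) π := fun i =>
    integrable_comp_eval (μ := fun _ : Fin n => ν) (f := fun y : ℝ => y ^ 2) hsq
  have hi2 : ∀ i, Integrable (fun x : Fin n → ℝ => Real.log (x i)) π := fun i =>
    integrable_comp_eval (μ := fun _ : Fin n => ν) hlog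
  have hi3 : ∀ i, Integrable (fun x : Fin n → ℝ => L (x i)) π := fun i =>
    integrable_comp_eval (μ := fun _ : Fin n => ν) hL
  have hi4 : ∀ i, ∀ j ∈ Finset.Ioi i, Integrable (fun x : Fin n → ℝ => Real.log (x i - x j)) π :=
    fun i j hj => (measurePreserving_pair ν (Finset.mem_Ioi.1 hj).ne).integrable_comp_of_integrable
      (h.integrable_log_prod ha)
  have hI1 := (integrable_finsetSum Finset.univ fun i _ => hi1 i).const_mul (-(n * β / 2))
  have hI2 := (integrable_finsetSum Finset.univ fun i _ => hi2 i).const_mul (β * μn)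
  have hI3 := integrable_finsetSum Finset.univ fun i _ => hi3 i
  have hI4 := (integrable_finsetSum Finset.univ fun i _ =>
    integrable_finsetSum (Finset.Ioi i) fun j hj => hi4 i j hj).const_mul β
  have hui : Integrable u π := ((hI1.add hI2).add hI4).sub hI3
  have hpair : ∀ i, ∀ j ∈ Finset.Ioi i, ∫ x : Fin n → ℝ, Real.log (x i - x j) ∂π = E := by
    intro i j hj
    have hmp := measurePreserving_pair ν (Finset.mem_Ioi.1 hj).ne
    have hm : AEStronglyMeasurable (fun z : ℝ × ℝ => Real.log (z.1 - z.2)) (ν.prod ν) :=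
      (h.integrable_log_prod ha).1
    rw [← hmp.map_eq] at hm
    have := integral_map hmp.measurable.aemeasurable hm
    rw [hmp.map_eq, integral_prod _ (h.integrable_log_prod ha)] at this
    rw [← this]
    rfl
  have hue : ∫ x, u x ∂π = m := by
    have hcount := sum_sum_eq_of_symm (n := n) (fun _ _ => E) fun _ _ => rfl
    simp only [Finset.sum_const, Finset.card_univ, Fintype.card_fin, nsmul_eq_mul] at hcount
    simp only [hu]
    rw [integral_sub ((hI1.fun_add hI2).fun_add hI4) hI3, integral_add (hI1.fun_add hI2) hI4,
      integral_add hI1 hI2, integral_const_mul, integral_const_mul, integral_const_mul,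
      integral_finsetSum _ fun i _ => hi1 i, integral_finsetSum _ fun i _ => hi2 i,
      integral_finsetSum _ fun i _ => hi3 i, integral_finsetSum _ fun i _ =>
        integrable_finsetSum (Finset.Ioi i) fun j hj => hi4 i j hj]
    have e1 : ∀ i, ∫ x : Fin n → ℝ, x i ^ 2 ∂π = ∫ y, y ^ 2 ∂ν := fun i =>
      integral_comp_eval (μ := fun _ : Fin n => ν) (f := fun y : ℝ => y ^ 2) hsq.1
    have e2 : ∀ i, ∫ x : Fin n → ℝ, Real.log (x i) ∂π = Λ := fun i =>
      integral_comp_eval (μ := fun _ : Fin n => ν) hlog.1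
    have e3 : ∀ i, ∫ x : Fin n → ℝ, L (x i) ∂π = I := fun i =>
      integral_comp_eval (μ := fun _ : Fin n => ν) hL.1
    have e4 : ∀ i, ∫ x : Fin n → ℝ, ∑ j ∈ Finset.Ioi i, Real.log (x i - x j) ∂π =
        ∑ j ∈ Finset.Ioi i, E := fun i => by
      rw [integral_finsetSum _ fun j hj => hi4 i j hj]
      exact Finset.sum_congr rfl fun j hj => hpair i j hj
    simp only [e1, e2, e3, e4, hsq_int, Finset.sum_const, Finset.card_univ, Fintype.card_fin,
      nsmul_eq_mul]
    rw [hm]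
    linear_combination (-β / 2) * hcount
  have hcoord : ∀ᵐ x ∂π, ∀ i, x i ∈ Icc a b := ae_all_iff.2 fun i =>
    (measurePreserving_eval (fun _ : Fin n => ν) i).quasiMeasurePreserving.ae h.supp
  have hdist : ∀ᵐ x ∂π, ∀ i, ∀ j ∈ Finset.Ioi i, x i - x j ≠ 0 := by
    refine ae_all_iff.2 fun i => ae_all_iff.2 fun j => ?_
    by_cases hj : j ∈ Finset.Ioi i
    · have h2 : ∀ᵐ z : ℝ × ℝ ∂(ν.prod ν), z.1 - z.2 ≠ 0 := by
        refine (Measure.ae_prod_iff_ae_ae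
          ((measurableSet_singleton (0 : ℝ)).compl.preimage (by fun_prop))).2
            (ae_of_all _ fun y => ?_)
        filter_upwards [compl_mem_ae_iff.2 (measure_singleton (μ := ν) y)] with z hz
        exact sub_ne_zero.2 fun hyz => hz hyz.symm
      exact ((measurePreserving_pair ν (Finset.mem_Ioi.1 hj).ne).quasiMeasurePreserving.ae
        h2).mono fun x hx _ => hx
    · exact ae_of_all _ fun x hx => absurd hx hj
  set g : (Fin n → ℝ) → ℝ := fun x => Real.exp (m) * (1 + (u x - m)) with hg
  have hgi : Integrable g π := ((integrable_const _).add (hui.sub (integrable_const _))).const_mul _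
  have hge : ∫ x, g x ∂π = Real.exp m := by
    simp only [hg]
    rw [integral_const_mul, integral_add (integrable_const _)
      (show Integrable (fun x => u x - m) π from hui.sub (integrable_const _)),
      integral_sub hui (integrable_const _), hue]
    simp
  have hle : ∀ᵐ x ∂π, g x ≤ S.indicator (eigDens β μn n) x * Real.exp (-∑ i, L (x i)) := by
    filter_upwards [hcoord, hdist] with x hx hxd
    have hx0 : ∀ i, 0 < x i := fun i => ha.trans_le (hx i).1
    have hxS : x ∈ S := fun i => hσa.trans (hx i).1
    have e1 : ∏ i, x i ^ (β * μn) = Real.exp (β * μn * ∑ i, Real.log (x i)) := by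
      rw [Finset.mul_sum, Real.exp_sum]
      refine Finset.prod_congr rfl fun i _ => ?_
      rw [Real.rpow_def_of_pos (hx0 i), mul_comm]
    have e2 : ∏ i, ∏ j ∈ Finset.Ioi i, |x i - x j| ^ β =
        Real.exp (β * ∑ i, ∑ j ∈ Finset.Ioi i, Real.log (x i - x j)) := by
      simp only [Finset.mul_sum, Real.exp_sum]
      refine Finset.prod_congr rfl fun i _ => Finset.prod_congr rfl fun j hj => ?_
      rw [Real.rpow_def_of_pos (abs_pos.2 (hxd i j hj)), Real.log_abs, mul_comm]
    rw [indicator_of_mem hxS, eigDens, e1, e2, ← Real.exp_add, ← Real.exp_add, ← Real.exp_add]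
    have e3 : Real.exp (β * μn * ∑ i, Real.log (x i) + -(n * β / 2) * ∑ i, x i ^ 2 +
        β * ∑ i, ∑ j ∈ Finset.Ioi i, Real.log (x i - x j) + -∑ i, L (x i)) =
        Real.exp m * Real.exp (u x - m) := by
      rw [← Real.exp_add]
      congr 1
      simp only [hu]
      ring
    rw [e3]
    have := Real.add_one_le_exp (u x - m)
    simp only [hg]
    gcongr
    linarith
  have hfi : Integrable f := by
    refine ⟨hf.aestronglyMeasurable, ?_⟩
    rw [hasFiniteIntegral_iff_ofReal (ae_of_all _ hf0)]
    have h1 : ν univ = 1 := measure_univ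
    rw [hν, withDensity_apply _ MeasurableSet.univ, Measure.restrict_univ] at h1
    simp [h1]
  have hSi : 0 ≤ᵐ[volume] S.indicator (eigDens β μn n) := by
    refine ae_of_all _ fun x => indicator_nonneg (fun x hx => ?_) x
    have : ∀ i, 0 ≤ x i := fun i => hσ.le.trans (hx i)
    exact mul_nonneg (mul_nonneg (Finset.prod_nonneg fun i _ => Real.rpow_nonneg (this i) _)
      (Real.exp_pos _).le) (Finset.prod_nonneg fun i _ => Finset.prod_nonneg fun j _ =>
        Real.rpow_nonneg (abs_nonneg _) _)
  have hπd : π = volume.withDensity fun x => ENNReal.ofReal (∏ i, f (x i)) := by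
    rw [hπ, ← pi_withDensity hf0 hfi, ← hν]
  rw [← integral_indicator hSm]
  refine (ENNReal.ofReal_le_ofReal_iff (integral_nonneg_of_ae hSi)).1 ?_
  rw [ofReal_integral_eq_lintegral_ofReal ((integrable_indicator_iff hSm).2 hint) hSi, ← hge]
  calc ENNReal.ofReal (∫ x, g x ∂π) ≤ ∫⁻ x, ENNReal.ofReal (g x) ∂π := ?_
    _ ≤ ∫⁻ x, ENNReal.ofReal (S.indicator (eigDens β μn n) x * Real.exp (-∑ i, L (x i))) ∂π :=
      lintegral_mono_ae (hle.mono fun x hx => ENNReal.ofReal_le_ofReal hx)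
    _ ≤ ∫⁻ x, ENNReal.ofReal (S.indicator (eigDens β μn n) x) := ?_
  · rw [integral_eq_lintegral_pos_part_sub_lintegral_neg_part hgi]
    exact (ENNReal.ofReal_le_ofReal (sub_le_self _ ENNReal.toReal_nonneg)).trans
      ENNReal.ofReal_toReal_le
  · rw [hπd]
    refine (lintegral_withDensity_le_lintegral_mul _ (by fun_prop) _).trans ?_
    refine lintegral_mono_ae (hSi.mono fun x hx => ?_)
    have h1 : 0 ≤ ∏ i, f (x i) := Finset.prod_nonneg fun i _ => hf0 _
    have h2 : ∏ i, f (x i) ≤ Real.exp (∑ i, L (x i)) := by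
      rw [Real.exp_sum]
      exact Finset.prod_le_prod (fun i _ => hf0 _) fun i _ => hfL _
    rw [Pi.mul_apply, ← ENNReal.ofReal_mul h1]
    refine ENNReal.ofReal_le_ofReal ?_
    calc (∏ i, f (x i)) * (S.indicator (eigDens β μn n) x * Real.exp (-∑ i, L (x i)))
        ≤ Real.exp (∑ i, L (x i)) * (S.indicator (eigDens β μn n) x *
          Real.exp (-∑ i, L (x i))) :=
          mul_le_mul_of_nonneg_right h2 (mul_nonneg hx (Real.exp_pos _).le)
      _ = S.indicator (eigDens β μn n) x * Real.exp (∑ i, L (x i) + -∑ i, L (x i)) := by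
          rw [Real.exp_add]; ring
      _ = _ := by simp

end IsEquilibrium

/-- The configurations contained in `[σ, ∞)`. -/
def confined (σ : ℝ) (n : ℕ) : Set (Fin n → ℝ) := {x | ∀ i, σ ≤ x i}

/-- The partition function of the confined ensemble. -/
noncomputable def partitionFn (β μn σ : ℝ) (n : ℕ) : ℝ := ∫ x in confined σ n, eigDens β μn n x

/-- The law of the confined eigenvalues. -/
noncomputable def gibbs (β μn σ : ℝ) (n : ℕ) : Measure (Fin n → ℝ) :=
  ENNReal.ofReal (partitionFn β μn σ n)⁻¹ •
    (volume.restrict (confined σ n)).withDensity fun x => ENNReal.ofReal (eigDens β μn n x)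

lemma measurableSet_confined (σ : ℝ) (n : ℕ) : MeasurableSet (confined σ n) := by
  rw [confined, ofPred_forall]
  exact MeasurableSet.iInter fun i => measurableSet_le measurable_const (measurable_pi_apply i)

lemma measurable_eigDens (β μn : ℝ) (n : ℕ) : Measurable (eigDens β μn n) := by
  unfold eigDens
  fun_prop

lemma eigDens_nonneg {β μn σ : ℝ} {n : ℕ} (hσ : 0 < σ) {x : Fin n → ℝ} (hx : x ∈ confined σ n) :
    0 ≤ eigDens β μn n x := by
  have : ∀ i, 0 ≤ x i := fun i => hσ.le.trans (hx i)
  exact mul_nonneg (mul_nonneg (Finset.prod_nonneg fun i _ => Real.rpow_nonneg (this i) _)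
    (Real.exp_pos _).le) (Finset.prod_nonneg fun i _ => Finset.prod_nonneg fun j _ =>
      Real.rpow_nonneg (abs_nonneg _) _)

lemma integral_gibbs {β μn σ : ℝ} {n : ℕ} (hσ : 0 < σ) (hZ : 0 < partitionFn β μn σ n)
    {E : Type*} [NormedAddCommGroup E] [NormedSpace ℝ E] (g : (Fin n → ℝ) → E) :
    ∫ x, g x ∂(gibbs β μn σ n) =
      (partitionFn β μn σ n)⁻¹ • ∫ x in confined σ n, eigDens β μn n x • g x := by
  rw [gibbs, integral_smul_measure, integral_withDensity_eq_integral_toReal_smul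
    (measurable_eigDens β μn n).ennreal_ofReal (ae_of_all _ fun _ => ENNReal.ofReal_lt_top),
    ENNReal.toReal_ofReal (inv_nonneg.2 hZ.le)]
  congr 1
  refine setIntegral_congr_fun (measurableSet_confined σ n) fun x hx => ?_
  simp only [ENNReal.toReal_ofReal (eigDens_nonneg hσ hx)]

lemma isProbabilityMeasure_gibbs {β μn σ : ℝ} {n : ℕ} (hσ : 0 < σ)
    (hZ : 0 < partitionFn β μn σ n) (hint : IntegrableOn (eigDens β μn n) (confined σ n)) :
    IsProbabilityMeasure (gibbs β μn σ n) := by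
  constructor
  rw [gibbs, Measure.smul_apply, withDensity_apply _ MeasurableSet.univ, Measure.restrict_univ,
    ← ofReal_integral_eq_lintegral_ofReal hint ((ae_restrict_iff' (measurableSet_confined σ n)).2
      (ae_of_all _ fun x hx => eigDens_nonneg hσ hx)), smul_eq_mul, ← ENNReal.ofReal_mul
      (inv_nonneg.2 hZ.le)]
  change ENNReal.ofReal ((partitionFn β μn σ n)⁻¹ * partitionFn β μn σ n) = 1
  rw [inv_mul_cancel₀ hZ.ne', ENNReal.ofReal_one]

/-- The mean empirical measure of the confined eigenvalues. -/
noncomputable def meanMeasure (β μn σ : ℝ) (n : ℕ) : Measure ℝ :=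
  (n : ENNReal)⁻¹ • ∑ i : Fin n, (gibbs β μn σ n).map fun x => x i

lemma isProbabilityMeasure_meanMeasure {β μn σ : ℝ} {n : ℕ} (hn : n ≠ 0)
    [IsProbabilityMeasure (gibbs β μn σ n)] :
    IsProbabilityMeasure (meanMeasure β μn σ n) := by
  have : ∀ i : Fin n, IsProbabilityMeasure ((gibbs β μn σ n).map fun x => x i) := fun i =>
    Measure.isProbabilityMeasure_map (measurable_pi_apply i).aemeasurable
  constructor
  simp [meanMeasure, measure_univ, ENNReal.inv_mul_cancel, hn]

lemma integral_meanMeasure {β μn σ : ℝ} {n : ℕ} [IsProbabilityMeasure (gibbs β μn σ n)]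
    {E : Type*} [NormedAddCommGroup E] [NormedSpace ℝ E] [CompleteSpace E] {g : ℝ → E}
    (hg : StronglyMeasurable g) {M : ℝ} (hM : ∀ x, ‖g x‖ ≤ M) :
    ∫ y, g y ∂(meanMeasure β μn σ n) =
      ∫ x, (∫ y, g y ∂(empMeasure x)) ∂(gibbs β μn σ n) := by
  have hi : ∀ (ρ : Measure ℝ) [IsFiniteMeasure ρ], Integrable g ρ := fun ρ _ =>
    (integrable_const M).mono' hg.aestronglyMeasurable (ae_of_all _ hM)
  have hi' : ∀ i : Fin n, Integrable (fun x : Fin n → ℝ => g (x i)) (gibbs β μn σ n) := fun i =>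
    (integrable_const M).mono' (hg.comp_measurable (measurable_pi_apply i)).aestronglyMeasurable
      (ae_of_all _ fun x => hM _)
  simp_rw [integral_empMeasure]
  rw [integral_smul, integral_finsetSum _ fun i _ => hi' i, meanMeasure, integral_smul_measure,
    integral_finsetSum_measure fun i _ => hi _]
  simp only [ENNReal.toReal_inv, ENNReal.toReal_natCast]
  congr 1
  exact Finset.sum_congr rfl fun i _ => integral_map (measurable_pi_apply i).aemeasurable
    hg.aestronglyMeasurable

lemma charFun_meanMeasure {β μn σ : ℝ} {n : ℕ} [IsProbabilityMeasure (gibbs β μn σ n)] (k : ℝ) :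
    charFun (meanMeasure β μn σ n) k = ∫ x, charFun (empMeasure x) k ∂(gibbs β μn σ n) := by
  simp_rw [charFun_apply_real]
  refine integral_meanMeasure (M := 1) (Continuous.stronglyMeasurable (by fun_prop)) fun x => ?_
  rw [← Complex.ofReal_mul, Complex.norm_exp_ofReal_mul_I]

lemma continuous_charFun_empMeasure {n : ℕ} (k : ℝ) :
    Continuous fun x : Fin n → ℝ => charFun (empMeasure x) k := by
  simp_rw [charFun_apply_real, integral_empMeasure]
  fun_prop

namespace IsEquilibrium

variable {ν : Measure ℝ} {α σ a b ℓ C β : ℝ} {μ : ℕ → ℝ}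

/-- The mean squared distance of the characteristic functions is controlled by any `η`. -/
lemma exists_integral_charFun_le (h : IsEquilibrium ν α σ a b ℓ C) (hβ : 0 < β) (hα : 0 < α)
    (hσ : 0 < σ) (hσa : σ ≤ a) (hμ : Tendsto (fun n : ℕ => μ n / n) atTop (𝓝 α)) {k : ℝ}
    (hk : 0 ≤ k) :
    ∃ κ > 0, ∃ C₁ : ℝ, ∃ err : ℕ → ℝ, Tendsto err atTop (𝓝 0) ∧
      ∀ η, 0 < η → η ≤ 1 / 2 → ∀ᶠ n : ℕ in atTop,
        IsProbabilityMeasure (gibbs β (μ n) σ n) ∧ 0 < partitionFn β (μ n) σ n ∧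
        ∫ x, ‖charFun (empMeasure x) k - charFun ν k‖ ^ 2 ∂(gibbs β (μ n) σ n) ≤
          (C₁ * η ^ 3 + err n) / (κ * η) := by
  have := h.prob
  obtain ⟨κ, hκ, C₁, c, err, herr, hup⟩ := h.eigDens_upper hβ hα hσ hσa hμ hk
  obtain ⟨Λ, I, hlow⟩ := h.exists_exp_le_integral_eigDens hσ hσa (β := β)
  set E := ∫ y, logPot ν y ∂ν
  set G : ℝ → ℝ := fun y => Real.exp (-(β / 4) * (y ^ 2 / 2 - c)) with hG
  have hGi : Integrable G := by
    have := (integrable_exp_neg_mul_sq (show 0 < β / 8 by positivity)).const_mul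
      (Real.exp (β / 4 * c))
    refine this.congr (ae_of_all _ fun y => ?_)
    simp only [hG, ← Real.exp_add]
    congr 1
    ring
  have hK : 0 < ∫ y, G y := integral_exp_pos hGi
  set K := ∫ y, G y
  refine ⟨κ, hκ, C₁, fun n => err n + (2 / β * Real.log K + E + 2 / β * I) * (1 / n)
    - 2 * Λ * (μ n / n - α), ?_, fun η hη hη' => ?_⟩
  · simpa using (herr.add (tendsto_one_div_atTop_nhds_zero_nat.const_mul
      (2 / β * Real.log K + E + 2 / β * I))).sub ((hμ.sub_const α).const_mul (2 * Λ))
  filter_upwards [hup η hη hη', eventually_ge_atTop 1] with n hn hn1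
  have hn0 : n ≠ 0 := by omega
  have hnp : (0 : ℝ) < n := by positivity
  set S := confined σ n with hS
  have hSm : MeasurableSet S := measurableSet_confined σ n
  set A := Real.exp (-(β / 2) * n ^ 2 * (ℓ + E - C₁ * η ^ 3 - err n)) with hA
  set t := β / 2 * n ^ 2 * (κ * η) with ht
  have htp : 0 < t := by positivity
  set D : (Fin n → ℝ) → ℝ := fun x => ‖charFun (empMeasure x) k - charFun ν k‖ ^ 2 with hD
  have hD0 : ∀ x, 0 ≤ D x := fun x => by positivity
  have hDc : Continuous D := by
    have := continuous_charFun_empMeasure (n := n) k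
    fun_prop
  have hprod : Integrable (fun x : Fin n → ℝ => A * ∏ i, G (x i)) :=
    (Integrable.fintype_prod fun _ => hGi).const_mul A
  have hprod_int : ∫ x : Fin n → ℝ, A * ∏ i, G (x i) = A * K ^ n := by
    rw [integral_const_mul, integral_fintype_prod_volume_eq_pow, Fintype.card_fin]
  have hpos : ∀ x : Fin n → ℝ, 0 ≤ A * ∏ i, G (x i) := fun x =>
    mul_nonneg (Real.exp_pos _).le (Finset.prod_nonneg fun i _ => (Real.exp_pos _).le)
  have hbd : ∀ x ∈ S, eigDens β (μ n) n x * Real.exp (t * D x) ≤ A * ∏ i, G (x i) := by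
    intro x hx
    have e : t * D x = β / 2 * n ^ 2 * (κ * η * ‖charFun (empMeasure x) k - charFun ν k‖ ^ 2) := by
      simp only [ht, hD]; ring
    rw [e]
    exact hn x hx
  have hbd' : ∀ x ∈ S, eigDens β (μ n) n x ≤ A * ∏ i, G (x i) := fun x hx =>
    (le_mul_of_one_le_right (eigDens_nonneg hσ hx) (Real.one_le_exp (mul_nonneg htp.le
      (hD0 x)))).trans (hbd x hx)
  have hint : IntegrableOn (eigDens β (μ n) n) S := by
    refine Integrable.mono' hprod.integrableOn (measurable_eigDens _ _ _).aestronglyMeasurable ?_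
    refine (ae_restrict_iff' hSm).2 (ae_of_all _ fun x hx => ?_)
    rw [Real.norm_of_nonneg (eigDens_nonneg hσ hx)]
    exact hbd' x hx
  have hlo := hlow n (μ n) hint
  set m₀ := -(β / 2) * (n ^ 2 * (ℓ + E) + n * E) + β * (μ n - α * n) * n * Λ - n * I with hm₀
  have hZlo : Real.exp m₀ ≤ partitionFn β (μ n) σ n := hlo
  set Z := partitionFn β (μ n) σ n with hZdef
  have hZ : 0 < Z := (Real.exp_pos _).trans_le hZlo
  have hP := isProbabilityMeasure_gibbs hσ hZ hint
  refine ⟨hP, hZ, ?_⟩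
  set m := Real.log (A * K ^ n) - m₀ with hm
  have hAK : 0 < A * K ^ n := mul_pos (Real.exp_pos _) (pow_pos hK n)
  have hem : Real.exp (-m) * (A * K ^ n) = Real.exp m₀ := by
    nth_rewrite 1 [← Real.exp_log hAK]
    rw [← Real.exp_add, hm]
    congr 1
    ring
  have hpt : ∀ x ∈ S, t * (eigDens β (μ n) n x * D x) ≤
      (m - 1) * eigDens β (μ n) n x + Real.exp (-m) * (A * ∏ i, G (x i)) := by
    intro x hx
    have e0 := eigDens_nonneg (β := β) (μn := μ n) hσ hx
    have e1 := Real.add_one_le_exp (t * D x - m)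
    have e2 : Real.exp (t * D x - m) = Real.exp (-m) * Real.exp (t * D x) := by
      rw [← Real.exp_add]; congr 1; ring
    calc t * (eigDens β (μ n) n x * D x) = eigDens β (μ n) n x * (t * D x) := by ring
      _ ≤ eigDens β (μ n) n x * (m - 1 + Real.exp (-m) * Real.exp (t * D x)) := by
        gcongr
        linarith
      _ = (m - 1) * eigDens β (μ n) n x
          + Real.exp (-m) * (eigDens β (μ n) n x * Real.exp (t * D x)) := by ring
      _ ≤ _ := by
        have := mul_le_mul_of_nonneg_left (hbd x hx) (Real.exp_pos (-m)).le
        linarith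
  have hDi : IntegrableOn (fun x => eigDens β (μ n) n x * D x) S := by
    refine Integrable.mono' (hprod.integrableOn.const_mul (t⁻¹))
      ((measurable_eigDens _ _ _).mul hDc.measurable).aestronglyMeasurable ?_
    refine (ae_restrict_iff' hSm).2 (ae_of_all _ fun x hx => ?_)
    have e0 := eigDens_nonneg (β := β) (μn := μ n) hσ hx
    rw [Real.norm_of_nonneg (mul_nonneg e0 (hD0 x)), le_inv_mul_iff₀ htp]
    refine le_trans ?_ (hbd x hx)
    have e1 := Real.add_one_le_exp (t * D x)
    calc t * (eigDens β (μ n) n x * D x) = eigDens β (μ n) n x * (t * D x) := by ring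
      _ ≤ _ := by gcongr; linarith
  have hmain : t * ∫ x in S, eigDens β (μ n) n x * D x ≤ m * Z := by
    rw [← integral_const_mul]
    calc ∫ x in S, t * (eigDens β (μ n) n x * D x)
        ≤ ∫ x in S, ((m - 1) * eigDens β (μ n) n x + Real.exp (-m) * (A * ∏ i, G (x i))) :=
          setIntegral_mono_on (hDi.const_mul t) ((hint.const_mul _).add
            (hprod.integrableOn.const_mul _)) hSm hpt
      _ = (m - 1) * Z + Real.exp (-m) * ∫ x in S, A * ∏ i, G (x i) := by
          rw [integral_add (hint.const_mul _) (hprod.integrableOn.const_mul _),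
            integral_const_mul, integral_const_mul]
          rfl
      _ ≤ (m - 1) * Z + Real.exp (-m) * (A * K ^ n) := by
          gcongr
          rw [← hprod_int]
          exact setIntegral_le_integral hprod (ae_of_all _ hpos)
      _ ≤ m * Z := by rw [hem]; linarith
  rw [integral_gibbs hσ hZ, ← hZdef, smul_eq_mul]
  simp only [smul_eq_mul]
  have e1 : m = t * ((C₁ * η ^ 3 + (err n + (2 / β * Real.log K + E + 2 / β * I) * (1 / n)
      - 2 * Λ * (μ n / n - α))) / (κ * η)) := by
    rw [hm, Real.log_mul (Real.exp_pos _).ne' (pow_pos hK n).ne', Real.log_exp, Real.log_pow,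
      hm₀, ht]
    field_simp
    ring
  rw [inv_mul_le_iff₀ hZ, ← mul_le_mul_iff_right₀ htp]
  refine hmain.trans (le_of_eq ?_)
  rw [e1]
  ring

/-- The mean empirical characteristic function converges to that of the equilibrium measure. -/
lemma tendsto_charFun_meanMeasure_of_nonneg (h : IsEquilibrium ν α σ a b ℓ C) (hβ : 0 < β)
    (hα : 0 < α) (hσ : 0 < σ) (hσa : σ ≤ a)
    (hμ : Tendsto (fun n : ℕ => μ n / n) atTop (𝓝 α)) {k : ℝ} (hk : 0 ≤ k) :
    Tendsto (fun n => charFun (meanMeasure β (μ n) σ n) k) atTop (𝓝 (charFun ν k)) := by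
  have := h.prob
  obtain ⟨κ, hκ, C₁, err, herr, hmain⟩ := h.exists_integral_charFun_le hβ hα hσ hσa hμ hk
  rw [Metric.tendsto_nhds]
  intro s hs
  obtain ⟨η, hη, hη', hηs⟩ : ∃ η : ℝ, 0 < η ∧ η ≤ 1 / 2 ∧ C₁ * η ^ 2 / κ < s ^ 2 / 16 := by
    have h1 : Tendsto (fun η : ℝ => C₁ * η ^ 2 / κ) (𝓝[>] 0) (𝓝 0) := by
      have : Continuous fun η : ℝ => C₁ * η ^ 2 / κ := by fun_prop
      simpa using (this.tendsto 0).mono_left nhdsWithin_le_nhds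
    have h2 := h1.eventually (gt_mem_nhds (show 0 < s ^ 2 / 16 by positivity))
    have h3 : ∀ᶠ η : ℝ in 𝓝[>] 0, η ≤ 1 / 2 :=
      nhdsWithin_le_nhds (eventually_le_nhds (by norm_num))
    obtain ⟨η, ⟨e1, e2⟩, e3⟩ := ((h2.and h3).and self_mem_nhdsWithin).exists
    exact ⟨η, e3, e2, e1⟩
  have herr' : Tendsto (fun n => err n / (κ * η)) atTop (𝓝 0) := by
    simpa using herr.div_const (κ * η)
  filter_upwards [hmain η hη hη', herr'.eventually (gt_mem_nhds
    (show 0 < s ^ 2 / 16 by positivity)), eventually_ge_atTop 1] with n hn hn' hn1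
  obtain ⟨hP, -, hn⟩ := hn
  have hn0 : n ≠ 0 := by omega
  set P := gibbs β (μ n) σ n
  have hc := continuous_charFun_empMeasure (n := n) k
  have hb : ∀ x : Fin n → ℝ, ‖charFun (empMeasure x) k‖ ≤ 1 := fun x => by
    have := isProbabilityMeasure_empMeasure hn0 x
    exact norm_charFun_le_one k
  have hi : Integrable (fun x : Fin n → ℝ => charFun (empMeasure x) k) P :=
    (integrable_const (1 : ℝ)).mono' hc.aestronglyMeasurable (ae_of_all _ hb)
  have hb2 : ∀ x : Fin n → ℝ, ‖charFun (empMeasure x) k - charFun ν k‖ ≤ 2 := fun x =>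
    (norm_sub_le _ _).trans (by linarith [hb x, norm_charFun_le_one (μ := ν) k])
  have hi2 : Integrable (fun x : Fin n → ℝ => ‖charFun (empMeasure x) k - charFun ν k‖ ^ 2) P := by
    refine (integrable_const (4 : ℝ)).mono'
      ((hc.sub continuous_const).norm.pow 2).aestronglyMeasurable (ae_of_all _ fun x => ?_)
    rw [Real.norm_of_nonneg (by positivity)]
    nlinarith [hb2 x, norm_nonneg (charFun (empMeasure x) k - charFun ν k)]
  rw [dist_eq_norm, charFun_meanMeasure]
  have e1 : ∫ x, charFun (empMeasure x) k ∂P - charFun ν k =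
      ∫ x, (charFun (empMeasure x) k - charFun ν k) ∂P := by
    rw [integral_sub hi (integrable_const _)]
    simp
  rw [e1]
  have e2 : ∫ x, ‖charFun (empMeasure x) k - charFun ν k‖ ^ 2 ∂P < s ^ 2 / 8 := by
    have : (C₁ * η ^ 3 + err n) / (κ * η) = C₁ * η ^ 2 / κ + err n / (κ * η) := by
      field_simp
    linarith
  have e3 : ∫ x, (s / 4 + ‖charFun (empMeasure x) k - charFun ν k‖ ^ 2 / s) ∂P =
      s / 4 + (∫ x, ‖charFun (empMeasure x) k - charFun ν k‖ ^ 2 ∂P) / s := by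
    rw [integral_add (integrable_const _) (hi2.div_const s), integral_div s]
    simp
  have e4 : (∫ x, ‖charFun (empMeasure x) k - charFun ν k‖ ^ 2 ∂P) / s < s / 4 := by
    rw [div_lt_iff₀ hs]; nlinarith
  refine (norm_integral_le_of_norm_le ((integrable_const (s / 4)).add (hi2.div_const s))
    (ae_of_all _ fun x => ?_)).trans_lt (e3.trans_lt (by linarith))
  have : 0 ≤ (‖charFun (empMeasure x) k - charFun ν k‖ - s / 2) ^ 2 / s := by positivity
  have e5 : (‖charFun (empMeasure x) k - charFun ν k‖ - s / 2) ^ 2 / s =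
    s / 4 + ‖charFun (empMeasure x) k - charFun ν k‖ ^ 2 / s -
      ‖charFun (empMeasure x) k - charFun ν k‖ := by field_simp; ring
  simp only [Pi.add_apply]
  linarith

/-- The mean empirical measure of the confined eigenvalues converges weakly to the equilibrium
measure. -/
theorem tendsto_mean_empirical (h : IsEquilibrium ν α σ a b ℓ C) (hβ : 0 < β)
    (hα : 0 < α) (hσ : 0 < σ) (hσa : σ ≤ a)
    (hμ : Tendsto (fun n : ℕ => μ n / n) atTop (𝓝 α)) {g : ℝ → ℝ} (hg : Continuous g) {M : ℝ}
    (hM : ∀ x, |g x| ≤ M) :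
    Tendsto (fun n : ℕ =>
        (∫ x in confined σ n, ((1 / (n : ℝ)) * ∑ i, g (x i)) * eigDens β (μ n) n x) /
          ∫ x in confined σ n, eigDens β (μ n) n x)
      atTop (𝓝 (∫ y, g y ∂ν)) := by
  have := h.prob
  obtain ⟨κ, hκ, C₁, err, herr, hmain⟩ := h.exists_integral_charFun_le hβ hα hσ hσa hμ le_rfl
  obtain ⟨N, hN⟩ := eventually_atTop.1 ((hmain (1 / 2) (by norm_num) le_rfl).and
    (eventually_ge_atTop 1))
  have hP : ∀ n, IsProbabilityMeasure (gibbs β (μ (n + N)) σ (n + N)) := fun n =>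
    (hN (n + N) (by omega)).1.1
  have hZ : ∀ n, 0 < partitionFn β (μ (n + N)) σ (n + N) := fun n =>
    (hN (n + N) (by omega)).1.2.1
  have hne : ∀ n, n + N ≠ 0 := fun n => by have := (hN (n + N) (by omega)).2; omega
  let ρ : ℕ → ProbabilityMeasure ℝ := fun n =>
    ⟨meanMeasure β (μ (n + N)) σ (n + N), isProbabilityMeasure_meanMeasure (hne n)⟩
  have hρ : Tendsto ρ atTop (𝓝 ⟨ν, h.prob⟩) := by
    refine ProbabilityMeasure.tendsto_iff_tendsto_charFun.2 fun k => ?_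
    rcases le_total 0 k with hk | hk
    · exact (tendsto_add_atTop_iff_nat N).2
        (h.tendsto_charFun_meanMeasure_of_nonneg hβ hα hσ hσa hμ hk)
    · have h1 := (tendsto_add_atTop_iff_nat N).2
        (h.tendsto_charFun_meanMeasure_of_nonneg hβ hα hσ hσa hμ (neg_nonneg.2 hk))
      have h2 := (Complex.continuous_conj.tendsto _).comp h1
      simp only [charFun_neg, Function.comp_def, Complex.conj_conj] at h2
      exact h2
  rw [← tendsto_add_atTop_iff_nat N]
  let gb : BoundedContinuousFunction ℝ ℝ := BoundedContinuousFunction.ofNormedAddCommGroup g hg M hM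
  refine ((ProbabilityMeasure.tendsto_iff_forall_integral_tendsto.1 hρ) gb).congr fun n => ?_
  change ∫ y, g y ∂(meanMeasure β (μ (n + N)) σ (n + N)) = _
  rw [integral_meanMeasure hg.stronglyMeasurable hM, integral_gibbs hσ (hZ n), smul_eq_mul,
    inv_mul_eq_div]
  congr 1
  refine integral_congr_ae (ae_of_all _ fun x => ?_)
  simp only [integral_empMeasure, smul_eq_mul, one_div]
  ring

end IsEquilibrium

/-- Parametrization of `[a, b]` by `[0, π]`. -/
noncomputable def arc (a b θ : ℝ) : ℝ := (a + b) / 2 + (b - a) / 2 * Real.cos θ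

@[fun_prop]
lemma continuous_arc {a b : ℝ} : Continuous (arc a b) := by
  unfold arc; fun_prop

lemma arc_mem_Icc {a b : ℝ} (hab : a ≤ b) (θ : ℝ) : arc a b θ ∈ Icc a b := by
  have h1 := Real.neg_one_le_cos θ
  have h2 := Real.cos_le_one θ
  rw [arc]
  constructor <;> nlinarith

lemma sub_arc {a b : ℝ} (θ : ℝ) : b - arc a b θ = (b - a) / 2 * (1 - Real.cos θ) := by
  rw [arc]; ring

lemma arc_sub {a b : ℝ} (θ : ℝ) : arc a b θ - a = (b - a) / 2 * (1 + Real.cos θ) := by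
  rw [arc]; ring

lemma arc_mem_Ioo {a b : ℝ} (hab : a < b) {θ : ℝ} (hθ : θ ∈ Ioo 0 Real.pi) :
    arc a b θ ∈ Ioo a b := by
  have h1 : Real.cos θ < 1 := by
    have := Real.cos_lt_cos_of_nonneg_of_le_pi le_rfl hθ.2.le hθ.1
    rwa [Real.cos_zero] at this
  have h2 : -1 < Real.cos θ := by
    have := Real.cos_lt_cos_of_nonneg_of_le_pi hθ.1.le le_rfl hθ.2
    rwa [Real.cos_pi] at this
  constructor
  · rw [← sub_pos, arc_sub]; exact mul_pos (by linarith) (by linarith)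
  · rw [← sub_pos, sub_arc]; exact mul_pos (by linarith) (by linarith)

lemma arc_arccos {a b x : ℝ} (hab : a < b) (hx : x ∈ Icc a b) :
    arc a b (Real.arccos ((x - (a + b) / 2) / ((b - a) / 2))) = x := by
  have hr : 0 < (b - a) / 2 := by linarith
  rw [arc, Real.cos_arccos, mul_div_cancel₀ _ hr.ne']
  · ring
  · rw [le_div_iff₀ hr]; linarith [hx.1]
  · rw [div_le_one hr]; linarith [hx.2]

lemma injOn_arc {a b : ℝ} (hab : a < b) : InjOn (arc a b) (Ioo 0 Real.pi) := by
  intro θ hθ φ hφ h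
  have hr : (b - a) / 2 ≠ 0 := by linarith
  rw [arc, arc, add_right_inj, mul_right_inj' hr] at h
  exact Real.injOn_cos (Ioo_subset_Icc_self hθ) (Ioo_subset_Icc_self hφ) h

lemma image_arc {a b : ℝ} (hab : a < b) : arc a b '' Ioo 0 Real.pi = Ioo a b := by
  refine Subset.antisymm (image_subset_iff.2 fun θ hθ => arc_mem_Ioo hab hθ) fun x hx => ?_
  have hr : 0 < (b - a) / 2 := by linarith
  refine ⟨_, ⟨Real.arccos_pos.2 ?_, Real.arccos_lt_pi.2 ?_⟩,
    arc_arccos hab (Ioo_subset_Icc_self hx)⟩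
  · rw [div_lt_one hr]; linarith [hx.2]
  · rw [lt_div_iff₀ hr]; linarith [hx.1]

lemma hasDerivAt_arc (a b θ : ℝ) : HasDerivAt (arc a b) (-((b - a) / 2 * Real.sin θ)) θ := by
  have := ((Real.hasDerivAt_cos θ).const_mul ((b - a) / 2)).const_add ((a + b) / 2)
  rw [mul_neg] at this
  exact this

lemma abs_deriv_arc (a b θ : ℝ) :
    |-((b - a) / 2 * Real.sin θ)| = √((arc a b θ - a) * (b - arc a b θ)) := by
  rw [abs_neg, arc_sub, sub_arc, ← Real.sqrt_sq_eq_abs]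
  congr 1
  linear_combination ((b - a) / 2) ^ 2 * Real.sin_sq θ

lemma sqrt_mul_pos {a b y : ℝ} (hy : y ∈ Ioo a b) : 0 < √((y - a) * (b - y)) :=
  Real.sqrt_pos.2 (mul_pos (sub_pos.2 hy.1) (sub_pos.2 hy.2))

/-- Change of variables for the arcsine law. -/
lemma integral_arc {a b : ℝ} (hab : a < b) (g : ℝ → ℝ) :
    ∫ y in Ioo a b, g y = ∫ θ in Ioo 0 Real.pi,
      √((arc a b θ - a) * (b - arc a b θ)) * g (arc a b θ) := by
  conv_lhs => rw [← image_arc hab]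
  rw [integral_image_eq_integral_abs_deriv_smul measurableSet_Ioo
    (fun θ _ => (hasDerivAt_arc a b θ).hasDerivWithinAt) (injOn_arc hab)]
  exact setIntegral_congr_fun measurableSet_Ioo fun θ _ => by
    simp only [abs_deriv_arc a b θ, smul_eq_mul]

lemma integrableOn_arc {a b : ℝ} (hab : a < b) (g : ℝ → ℝ) :
    IntegrableOn g (Ioo a b) ↔ IntegrableOn (fun θ =>
      √((arc a b θ - a) * (b - arc a b θ)) * g (arc a b θ)) (Ioo 0 Real.pi) := by
  conv_lhs => rw [← image_arc hab]
  rw [integrableOn_image_iff_integrableOn_abs_deriv_smul measurableSet_Ioo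
    (fun θ _ => (hasDerivAt_arc a b θ).hasDerivWithinAt) (injOn_arc hab)]
  exact integrableOn_congr_fun (fun θ _ => by
    simp only [abs_deriv_arc a b θ, smul_eq_mul]) measurableSet_Ioo

/-- The arcsine law is compatible with inversion. -/
lemma integral_arc_inv {a b : ℝ} (ha : 0 < a) (hab : a < b) (g : ℝ → ℝ) :
    ∫ θ in Ioo 0 Real.pi, √(a * b) / arc a b θ * g (arc a b θ) =
      ∫ θ in Ioo 0 Real.pi, g (arc b⁻¹ a⁻¹ θ)⁻¹ := by
  have hb : 0 < b := ha.trans hab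
  have hab' : b⁻¹ < a⁻¹ := (inv_lt_inv₀ hb ha).2 hab
  have him : Inv.inv '' Ioo b⁻¹ a⁻¹ = Ioo a b := by
    ext y
    rw [Set.image_inv_eq_inv, Set.mem_inv]
    constructor
    · intro h
      have hy : 0 < y := inv_pos.1 ((inv_pos.2 hb).trans h.1)
      exact ⟨(inv_lt_inv₀ hy ha).1 h.2, (inv_lt_inv₀ hb hy).1 h.1⟩
    · intro h
      have hy : 0 < y := ha.trans h.1
      exact ⟨(inv_lt_inv₀ hb hy).2 h.2, (inv_lt_inv₀ hy ha).2 h.1⟩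
  have e1 : ∫ θ in Ioo 0 Real.pi, √(a * b) / arc a b θ * g (arc a b θ) =
      ∫ y in Ioo a b, (√((y - a) * (b - y)))⁻¹ * (√(a * b) / y * g y) := by
    rw [integral_arc hab]
    refine setIntegral_congr_fun measurableSet_Ioo fun θ hθ => ?_
    have := sqrt_mul_pos (arc_mem_Ioo hab hθ)
    rw [mul_inv_cancel_left₀ this.ne']
  have e2 : ∫ θ in Ioo 0 Real.pi, g (arc b⁻¹ a⁻¹ θ)⁻¹ =
      ∫ z in Ioo b⁻¹ a⁻¹, (√((z - b⁻¹) * (a⁻¹ - z)))⁻¹ * g z⁻¹ := by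
    rw [integral_arc hab']
    refine setIntegral_congr_fun measurableSet_Ioo fun θ hθ => ?_
    have := sqrt_mul_pos (arc_mem_Ioo hab' hθ)
    rw [mul_inv_cancel_left₀ this.ne']
  rw [e1, e2]
  conv_lhs => rw [← him]
  rw [integral_image_eq_integral_abs_deriv_smul (f' := fun z => -(z ^ 2)⁻¹) measurableSet_Ioo
    (fun z hz => (hasDerivAt_inv ((inv_pos.2 hb).trans hz.1).ne').hasDerivWithinAt)
    (inv_injective.injOn)]
  refine setIntegral_congr_fun measurableSet_Ioo fun z hz => ?_
  have hz0 : 0 < z := (inv_pos.2 hb).trans hz.1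
  have hz1 : 1 < b * z := (inv_lt_iff_one_lt_mul₀' hb).1 hz.1
  have hz2 : a * z < 1 := by rw [← lt_inv_mul_iff₀ ha, mul_one]; exact hz.2
  have e3 : √((z - b⁻¹) * (a⁻¹ - z)) * √(a * b) = √((z⁻¹ - a) * (b - z⁻¹)) * z := by
    rw [← Real.sqrt_mul (mul_nonneg (sub_pos.2 hz.1).le (sub_pos.2 hz.2).le)]
    have : (z - b⁻¹) * (a⁻¹ - z) * (a * b) = (z⁻¹ - a) * (b - z⁻¹) * z ^ 2 := by field_simp
    rw [this, Real.sqrt_mul' _ (sq_nonneg z), Real.sqrt_sq hz0.le]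
  have p1 := sqrt_mul_pos hz
  have p2 : 0 < √((z⁻¹ - a) * (b - z⁻¹)) := sqrt_mul_pos
    ⟨by rw [lt_inv_comm₀ ha hz0]; exact hz.2, by rw [inv_lt_comm₀ hz0 hb]; exact hz.1⟩
  simp only [smul_eq_mul, abs_neg, abs_of_pos (inv_pos.2 (pow_pos hz0 2))]
  generalize √((z - b⁻¹) * (a⁻¹ - z)) = p at *
  generalize √((z⁻¹ - a) * (b - z⁻¹)) = q at *
  generalize √(a * b) = w at *
  generalize g z⁻¹ = G at *
  field_simp
  linear_combination G * e3

lemma continuous_sin_mul_log_sin :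
    Continuous fun u : ℝ => Real.sin u * Real.log (Real.sin u) :=
  Real.continuous_mul_log.comp Real.continuous_sin

lemma intervalIntegrable_log_sin_mul {H : ℝ → ℝ} (hH : Continuous H) (c d : ℝ) :
    IntervalIntegrable (fun u => Real.log (Real.sin u) * H u) volume c d :=
  IntervalIntegrable.mul_continuousOn intervalIntegrable_log_sin hH.continuousOn

/-- Integration by parts against `log ∘ sin`. -/
lemma integral_log_sin_mul_deriv {H H' : ℝ → ℝ} (hH : ∀ u, HasDerivAt H (H' u) u)
    (hH' : Continuous H') :
    ∫ u in (0 : ℝ)..Real.pi, Real.log (Real.sin u) * (Real.cos u * H u + Real.sin u * H' u) =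
      -∫ u in (0 : ℝ)..Real.pi, Real.cos u * H u := by
  have hc : Continuous H := continuous_iff_continuousAt.2 fun u => (hH u).continuousAt
  have i1 := intervalIntegrable_log_sin_mul
    (H := fun u => Real.cos u * H u + Real.sin u * H' u) (by fun_prop) 0 Real.pi
  have i2 : IntervalIntegrable (fun u => Real.cos u * H u) volume 0 Real.pi :=
    Continuous.intervalIntegrable (by fun_prop) _ _
  have key := intervalIntegral.integral_eq_sub_of_hasDerivAt_of_le (a := 0) (b := Real.pi)
    (f := fun u => (Real.sin u * Real.log (Real.sin u)) * H u)
    (f' := fun u => Real.log (Real.sin u) * (Real.cos u * H u + Real.sin u * H' u)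
      + Real.cos u * H u) Real.pi_pos.le
    (continuous_sin_mul_log_sin.mul hc).continuousOn (fun u hu => ?_) (i1.add i2)
  · rw [intervalIntegral.integral_add i1 i2] at key
    simp only [Real.sin_pi, Real.sin_zero, zero_mul, sub_zero] at key
    linarith
  · have hs := (Real.sin_pos_of_pos_of_lt_pi hu.1 hu.2).ne'
    refine (((Real.hasDerivAt_sin u).mul ((Real.hasDerivAt_sin u).log hs)).mul
      (hH u)).congr_deriv ?_
    rw [Pi.mul_apply]
    field_simp
    ring

lemma integral_cos_mul_cos_add (t : ℝ) :
    ∫ u in (0 : ℝ)..Real.pi, Real.cos u * Real.cos (u + t) = Real.pi / 2 * Real.cos t := by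
  rw [intervalIntegral.integral_eq_sub_of_hasDerivAt
    (f := fun u => u / 2 * Real.cos t + Real.sin (2 * u + t) / 4) (fun u _ => ?_)
    (Continuous.intervalIntegrable (by fun_prop) _ _)]
  · have : Real.sin (2 * Real.pi + t) = Real.sin t := by
      rw [add_comm, Real.sin_add_two_pi]
    simp [this]
  · have h := (((hasDerivAt_id u).div_const 2).mul_const (Real.cos t)).add
      (((((hasDerivAt_id u).const_mul 2).add_const t).sin).div_const 4)
    refine h.congr_deriv ?_
    simp only [id]
    have e1 : Real.cos (2 * u + t) = Real.cos (u + (u + t)) := by ring_nf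
    have e2 : Real.cos t = Real.cos ((u + t) - u) := by ring_nf
    rw [e1, e2, Real.cos_add, Real.cos_sub]
    ring

lemma integral_cos_sq_mul_cos_add (t : ℝ) :
    ∫ u in (0 : ℝ)..Real.pi, Real.cos u * (Real.cos u * Real.cos (2 * u + t)) =
      Real.pi / 4 * Real.cos t := by
  rw [intervalIntegral.integral_eq_sub_of_hasDerivAt
    (f := fun u => Real.sin (2 * u + t) / 4 + Real.sin (4 * u + t) / 16 + u / 4 * Real.cos t)
    (fun u _ => ?_) (Continuous.intervalIntegrable (by fun_prop) _ _)]
  · have h2 : Real.sin (2 * Real.pi + t) = Real.sin t := by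
      rw [add_comm, Real.sin_add_two_pi]
    have h4 : Real.sin (4 * Real.pi + t) = Real.sin t := by
      rw [← Real.sin_add_two_pi t, ← Real.sin_add_two_pi (t + _)]; ring_nf
    simp [h2, h4]
  · have h := ((((((hasDerivAt_id u).const_mul 2).add_const t).sin).div_const 4).add
      (((((hasDerivAt_id u).const_mul 4).add_const t).sin).div_const 16)).add
      (((hasDerivAt_id u).div_const 4).mul_const (Real.cos t))
    refine h.congr_deriv ?_
    simp only [id]
    have e1 : Real.cos (4 * u + t) + Real.cos t =
        2 * Real.cos (2 * u + t) * (2 * Real.cos u ^ 2 - 1) := by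
      rw [← Real.cos_two_mul, Real.cos_add_cos]
      ring_nf
    linear_combination e1 / 4

lemma integral_log_sin_mul_cos_two_mul (t : ℝ) :
    ∫ u in (0 : ℝ)..Real.pi, Real.log (Real.sin u) * Real.cos (2 * u + t) =
      -(Real.pi / 2 * Real.cos t) := by
  rw [← integral_cos_mul_cos_add, ← integral_log_sin_mul_deriv (H' := fun u => -Real.sin (u + t))
    (fun u => ?_) (by fun_prop)]
  · refine intervalIntegral.integral_congr fun u _ => ?_
    have e1 : Real.cos (2 * u + t) = Real.cos (u + (u + t)) := by ring_nf
    simp only [e1, Real.cos_add u (u + t)]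
    ring
  · simpa using ((hasDerivAt_id u).add_const t).cos

lemma integral_log_sin_mul_cos_four_mul (t : ℝ) :
    ∫ u in (0 : ℝ)..Real.pi, Real.log (Real.sin u) * Real.cos (4 * u + t) =
      -(Real.pi / 4 * Real.cos t) := by
  rw [← integral_cos_sq_mul_cos_add, ← integral_log_sin_mul_deriv
    (H' := fun u => -Real.sin u * Real.cos (2 * u + t) +
      Real.cos u * (-Real.sin (2 * u + t) * 2))
    (fun u => ?_) (by fun_prop)]
  · refine intervalIntegral.integral_congr fun u _ => ?_
    have e1 : Real.cos (4 * u + t) = Real.cos (2 * u + (2 * u + t)) := by ring_nf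
    simp only [e1, Real.cos_add (2 * u) (2 * u + t), Real.cos_two_mul u, Real.sin_two_mul u]
    linear_combination Real.log (Real.sin u) * Real.cos (2 * u + t) * (Real.sin_sq_add_cos_sq u)
  · have := (((hasDerivAt_id u).const_mul 2).add_const t).cos
    refine ((Real.hasDerivAt_cos u).mul this).congr_deriv ?_
    simp

lemma sum_half_angle (t θ : ℝ) : Real.cos t - Real.cos θ =
    2 * (Real.sin ((θ + t) / 2) * Real.sin ((θ - t) / 2)) := by
  rw [Real.cos_sub_cos, show (t - θ) / 2 = -((θ - t) / 2) by ring, Real.sin_neg, add_comm t θ]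
  ring

lemma intervalIntegrable_log_sin_half {F : ℝ → ℝ} (hF : Continuous F) (t c d : ℝ) :
    IntervalIntegrable (fun θ => Real.log (Real.sin ((θ + t) / 2)) * F θ) volume c d := by
  refine IntervalIntegrable.mul_continuousOn ?_ hF.continuousOn
  have := ((intervalIntegrable_log_sin (a := (c + t) / 2) (b := (d + t) / 2)).comp_mul_right
    (c := 1 / 2)).comp_add_right t
  convert this using 1
  · ext θ; simp [Function.comp, div_eq_mul_inv]
  · ring
  · ring

lemma log_cos_sub_cos {t θ : ℝ} (ht : t ∈ Icc 0 Real.pi) (hθ : θ ∈ Icc 0 Real.pi) (h : θ ≠ t) :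
    Real.log (Real.cos t - Real.cos θ) = Real.log 2 + Real.log (Real.sin ((θ + t) / 2)) +
      Real.log (Real.sin ((θ + -t) / 2)) := by
  have h1 : Real.cos t - Real.cos θ ≠ 0 := fun h2 => h (Real.injOn_cos hθ ht (by linarith))
  rw [sum_half_angle] at h1 ⊢
  have h2 := right_ne_zero_of_mul h1
  rw [Real.log_mul two_ne_zero h2, Real.log_mul (left_ne_zero_of_mul h2)
    (right_ne_zero_of_mul h2), ← sub_eq_add_neg]
  ring

lemma ae_ne_uIoc (t : ℝ) : ∀ᵐ θ ∂(volume.restrict (uIoc 0 Real.pi)), θ ≠ t :=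
  ae_restrict_of_ae (compl_mem_ae_iff.2 (by simp : volume ({t} : Set ℝ) = 0))

lemma ae_log_cos_sub_cos {t : ℝ} (ht : t ∈ Icc 0 Real.pi) (F : ℝ → ℝ) :
    (fun θ => Real.log (Real.cos t - Real.cos θ) * F θ) =ᵐ[volume.restrict (uIoc 0 Real.pi)]
      fun θ => Real.log 2 * F θ + (Real.log (Real.sin ((θ + t) / 2)) * F θ +
        Real.log (Real.sin ((θ + -t) / 2)) * F θ) := by
  filter_upwards [ae_ne_uIoc t, ae_restrict_mem measurableSet_uIoc] with θ h2 h3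
  rw [uIoc_of_le Real.pi_pos.le] at h3
  rw [log_cos_sub_cos ht (Ioc_subset_Icc_self h3) h2]
  ring

lemma intervalIntegrable_log_cos_sub {t : ℝ} (ht : t ∈ Icc 0 Real.pi) {F : ℝ → ℝ}
    (hF : Continuous F) :
    IntervalIntegrable (fun θ => Real.log (Real.cos t - Real.cos θ) * F θ) volume 0 Real.pi := by
  refine IntervalIntegrable.congr_ae ?_ (ae_log_cos_sub_cos ht F).symm
  exact (Continuous.intervalIntegrable (by fun_prop) _ _).add
    ((intervalIntegrable_log_sin_half hF t _ _).add (intervalIntegrable_log_sin_half hF (-t) _ _))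

lemma integral_log_cos_sub {t : ℝ} (ht : t ∈ Icc 0 Real.pi) {F : ℝ → ℝ} (hF : Continuous F)
    (heven : ∀ θ, F (-θ) = F θ) (hper : ∀ θ, F (θ + 2 * Real.pi) = F θ) :
    ∫ θ in (0 : ℝ)..Real.pi, Real.log (Real.cos t - Real.cos θ) * F θ =
      Real.log 2 * (∫ θ in (0 : ℝ)..Real.pi, F θ) +
        2 * ∫ u in (0 : ℝ)..Real.pi, Real.log (Real.sin u) * F (2 * u + t) := by
  have i1 : ∀ s c d, IntervalIntegrable (fun θ => Real.log (Real.sin ((θ + s) / 2)) * F θ)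
    volume c d := fun s c d => intervalIntegrable_log_sin_half hF s c d
  rw [intervalIntegral.integral_congr_ae_restrict (ae_log_cos_sub_cos ht F),
    intervalIntegral.integral_add (Continuous.intervalIntegrable (by fun_prop) _ _)
      ((i1 _ _ _).add (i1 _ _ _)),
    intervalIntegral.integral_add (i1 _ _ _) (i1 _ _ _), intervalIntegral.integral_const_mul]
  congr 1
  have e1 : ∫ θ in (0 : ℝ)..Real.pi, Real.log (Real.sin ((θ + t) / 2)) * F θ =
      ∫ θ in (-Real.pi)..0, Real.log (Real.sin ((θ + -t) / 2)) * F θ := by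
    have := intervalIntegral.integral_comp_neg (a := 0) (b := Real.pi)
      (fun θ => Real.log (Real.sin ((θ + -t) / 2)) * F θ)
    rw [neg_zero] at this
    rw [← this]
    refine intervalIntegral.integral_congr fun θ _ => ?_
    simp only [heven]
    rw [show (-θ + -t) / 2 = -((θ + t) / 2) by ring, Real.sin_neg, Real.log_neg_eq_log]
  rw [e1, intervalIntegral.integral_add_adjacent_intervals (i1 _ _ _) (i1 _ _ _)]
  have e2 : ∫ θ in (-Real.pi)..Real.pi, Real.log (Real.sin ((θ + -t) / 2)) * F θ =
      2 * ∫ u in ((-Real.pi - t) / 2)..((Real.pi - t) / 2),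
        Real.log (Real.sin u) * F (2 * u + t) := by
    have := intervalIntegral.integral_comp_mul_add (a := (-Real.pi - t) / 2)
      (b := (Real.pi - t) / 2)
      (fun θ => Real.log (Real.sin ((θ + -t) / 2)) * F θ) (two_ne_zero (α := ℝ)) t
    rw [smul_eq_mul] at this
    have e : ∀ u : ℝ, (2 * u + t + -t) / 2 = u := fun u => by ring
    simp only [e] at this
    rw [this, mul_inv_cancel_left₀ two_ne_zero]
    congr 1 <;> ring
  rw [e2]
  congr 1
  have hp : Function.Periodic (fun u => Real.log (Real.sin u) * F (2 * u + t)) Real.pi := by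
    intro u
    simp only
    rw [Real.sin_add_pi, Real.log_neg_eq_log, ← hper (2 * u + t)]
    ring_nf
  have := hp.intervalIntegral_add_eq ((-Real.pi - t) / 2) 0
  rw [zero_add] at this
  rw [← this]
  congr 1
  ring

lemma arc_sub_arc (a b t θ : ℝ) :
    arc a b t - arc a b θ = (b - a) / 2 * (Real.cos t - Real.cos θ) := by
  rw [arc, arc]; ring

lemma exists_arc_eq {a b x : ℝ} (hab : a < b) (hx : x ∈ Icc a b) :
    ∃ t ∈ Icc 0 Real.pi, arc a b t = x :=
  ⟨_, ⟨Real.arccos_nonneg _, Real.arccos_le_pi _⟩, arc_arccos hab hx⟩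

lemma ae_log_arc_sub_arc {a b t : ℝ} (hab : a < b) (ht : t ∈ Icc 0 Real.pi) (F : ℝ → ℝ) :
    (fun θ => Real.log (arc a b t - arc a b θ) * F θ) =ᵐ[volume.restrict (uIoc 0 Real.pi)]
      fun θ => Real.log ((b - a) / 2) * F θ + Real.log (Real.cos t - Real.cos θ) * F θ := by
  have hr : (b - a) / 2 ≠ 0 := by linarith
  filter_upwards [ae_ne_uIoc t, ae_restrict_mem measurableSet_uIoc] with θ h2 h3
  rw [uIoc_of_le Real.pi_pos.le] at h3
  have h4 : Real.cos t - Real.cos θ ≠ 0 := fun h =>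
    h2 (Real.injOn_cos (Ioc_subset_Icc_self h3) ht (by linarith))
  rw [arc_sub_arc, Real.log_mul hr h4, add_mul]

lemma sub_arc_ne_zero {a b x : ℝ} (hab : a < b) (hx : x ∉ Icc a b) (θ : ℝ) :
    x - arc a b θ ≠ 0 := fun h => hx (by
  rw [sub_eq_zero.1 h]; exact arc_mem_Icc hab.le θ)

lemma intervalIntegrable_log_sub_arc {a b : ℝ} (hab : a < b) (x : ℝ) {F : ℝ → ℝ}
    (hF : Continuous F) :
    IntervalIntegrable (fun θ => Real.log (x - arc a b θ) * F θ) volume 0 Real.pi := by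
  by_cases hx : x ∈ Icc a b
  · obtain ⟨t, ht, rfl⟩ := exists_arc_eq hab hx
    refine IntervalIntegrable.congr_ae ?_ (ae_log_arc_sub_arc hab ht F).symm
    exact (Continuous.intervalIntegrable (by fun_prop) _ _).add
      (intervalIntegrable_log_cos_sub ht hF)
  · refine Continuous.intervalIntegrable (Continuous.mul ?_ hF) _ _
    exact Continuous.log (by fun_prop) fun θ => sub_arc_ne_zero hab hx θ

lemma integral_log_arc_sub_arc {a b t : ℝ} (hab : a < b) (ht : t ∈ Icc 0 Real.pi) {F : ℝ → ℝ}
    (hF : Continuous F) (heven : ∀ θ, F (-θ) = F θ) (hper : ∀ θ, F (θ + 2 * Real.pi) = F θ) :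
    ∫ θ in (0 : ℝ)..Real.pi, Real.log (arc a b t - arc a b θ) * F θ =
      Real.log (b - a) * (∫ θ in (0 : ℝ)..Real.pi, F θ) +
        2 * ∫ u in (0 : ℝ)..Real.pi, Real.log (Real.sin u) * F (2 * u + t) := by
  rw [intervalIntegral.integral_congr_ae_restrict (ae_log_arc_sub_arc hab ht F),
    intervalIntegral.integral_add (Continuous.intervalIntegrable (by fun_prop) _ _)
      (intervalIntegrable_log_cos_sub ht hF), intervalIntegral.integral_const_mul,
    integral_log_cos_sub ht hF heven hper]
  have : Real.log ((b - a) / 2) = Real.log (b - a) - Real.log 2 :=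
    Real.log_div (by linarith) two_ne_zero
  rw [this]
  ring

lemma integral_log_sub_arc {a b x : ℝ} (hab : a < b) (hx : x ∈ Icc a b) :
    ∫ θ in (0 : ℝ)..Real.pi, Real.log (x - arc a b θ) =
      Real.pi * (Real.log (b - a) - 2 * Real.log 2) := by
  obtain ⟨t, ht, rfl⟩ := exists_arc_eq hab hx
  have := integral_log_arc_sub_arc (F := fun _ => 1) hab ht (by fun_prop) (fun _ => rfl)
    (fun _ => rfl)
  simp only [mul_one, integral_log_sin_zero_pi, intervalIntegral.integral_const, smul_eq_mul,
    sub_zero] at this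
  rw [this]
  ring

lemma integral_cos_zero_pi : ∫ θ in (0 : ℝ)..Real.pi, Real.cos θ = 0 := by simp

lemma integral_cos_two_mul_zero_pi : ∫ θ in (0 : ℝ)..Real.pi, Real.cos (2 * θ) = 0 := by
  rw [intervalIntegral.integral_comp_mul_left (fun x => Real.cos x) two_ne_zero]
  simp

lemma integral_log_sub_arc_mul_cos {a b t : ℝ} (hab : a < b) (ht : t ∈ Icc 0 Real.pi) :
    ∫ θ in (0 : ℝ)..Real.pi, Real.log (arc a b t - arc a b θ) * Real.cos θ =
      -(Real.pi * Real.cos t) := by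
  rw [integral_log_arc_sub_arc (F := Real.cos) hab ht (by fun_prop) Real.cos_neg
    Real.cos_add_two_pi, integral_cos_zero_pi, integral_log_sin_mul_cos_two_mul]
  ring

lemma integral_log_sub_arc_mul_cos_two_mul {a b t : ℝ} (hab : a < b) (ht : t ∈ Icc 0 Real.pi) :
    ∫ θ in (0 : ℝ)..Real.pi, Real.log (arc a b t - arc a b θ) * Real.cos (2 * θ) =
      -(Real.pi / 2 * Real.cos (2 * t)) := by
  rw [integral_log_arc_sub_arc (F := fun θ => Real.cos (2 * θ)) hab ht (by fun_prop)
    (fun θ => by rw [mul_neg, Real.cos_neg])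
    (fun θ => by
      rw [← Real.cos_add_two_pi (2 * θ), ← Real.cos_add_two_pi (2 * θ + _)]; ring_nf),
    integral_cos_two_mul_zero_pi]
  have e : ∀ u : ℝ, 2 * (2 * u + t) = 4 * u + 2 * t := fun u => by ring
  simp only [e, integral_log_sin_mul_cos_four_mul]
  ring

lemma intervalIntegral_zero_pi (f : ℝ → ℝ) :
    ∫ θ in (0 : ℝ)..Real.pi, f θ = ∫ θ in Ioo 0 Real.pi, f θ := by
  rw [intervalIntegral.integral_of_le Real.pi_pos.le, integral_Ioc_eq_integral_Ioo]

lemma integral_inv_arc {a b : ℝ} (ha : 0 < a) (hab : a < b) :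
    ∫ θ in (0 : ℝ)..Real.pi, √(a * b) / arc a b θ = Real.pi := by
  have := integral_arc_inv ha hab (fun _ => 1)
  rw [intervalIntegral_zero_pi]
  simpa [Real.pi_pos.le] using this

lemma integral_log_sub_arc_div {a b x : ℝ} (ha : 0 < a) (hab : a < b) (hx : x ∈ Icc a b) :
    ∫ θ in (0 : ℝ)..Real.pi, Real.log (x - arc a b θ) * (√(a * b) / arc a b θ) =
      Real.pi * Real.log x + (Real.pi * (Real.log (a⁻¹ - b⁻¹) - 2 * Real.log 2) -
        ∫ θ in (0 : ℝ)..Real.pi, Real.log (arc b⁻¹ a⁻¹ θ)) := by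
  have hb : 0 < b := ha.trans hab
  have hx0 : 0 < x := ha.trans_le hx.1
  have hab' : b⁻¹ < a⁻¹ := (inv_lt_inv₀ hb ha).2 hab
  have hx' : x⁻¹ ∈ Icc b⁻¹ a⁻¹ := ⟨inv_anti₀ hx0 hx.2, inv_anti₀ ha hx.1⟩
  have hpos : ∀ θ, 0 < arc b⁻¹ a⁻¹ θ := fun θ =>
    (inv_pos.2 hb).trans_le (arc_mem_Icc hab'.le θ).1
  have e1 := integral_arc_inv ha hab (fun y => Real.log (x - y))
  rw [← intervalIntegral_zero_pi, ← intervalIntegral_zero_pi] at e1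
  simp only [mul_comm (Real.log (x - _))]
  rw [e1, ← integral_log_sub_arc hab' hx']
  obtain ⟨t, ht, htx⟩ := exists_arc_eq hab' hx'
  have i1 := intervalIntegrable_log_sub_arc hab' x⁻¹ (F := fun _ => 1) (by fun_prop)
  simp only [mul_one] at i1
  have i2 : IntervalIntegrable (fun θ => Real.log (arc b⁻¹ a⁻¹ θ)) volume 0 Real.pi :=
    Continuous.intervalIntegrable (Continuous.log (by fun_prop) fun θ => (hpos θ).ne') _ _
  have e2 : (fun θ => Real.log (x - (arc b⁻¹ a⁻¹ θ)⁻¹)) =ᵐ[volume.restrict (uIoc 0 Real.pi)]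
      fun θ => Real.log x + (Real.log (x⁻¹ - arc b⁻¹ a⁻¹ θ) - Real.log (arc b⁻¹ a⁻¹ θ)) := by
    filter_upwards [ae_ne_uIoc t, ae_restrict_mem measurableSet_uIoc] with θ h2 h3
    rw [uIoc_of_le Real.pi_pos.le] at h3
    have h4 : x⁻¹ - arc b⁻¹ a⁻¹ θ ≠ 0 := by
      rw [← htx, arc_sub_arc]
      refine mul_ne_zero (by linarith) fun h => ?_
      exact h2 (Real.injOn_cos (Ioc_subset_Icc_self h3) ht (by linarith))
    have h5 := (hpos θ).ne'
    rw [← Real.log_div h4 h5, ← Real.log_mul hx0.ne' (div_ne_zero h4 h5), ← Real.log_neg_eq_log]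
    congr 1
    generalize arc b⁻¹ a⁻¹ θ = c at *
    field_simp
    ring
  rw [intervalIntegral.integral_congr_ae_restrict e2, intervalIntegral.integral_add (by simp)
    (i1.sub i2), intervalIntegral.integral_sub i1 i2]
  simp

/-- The Stieltjes transform of the arcsine law to the right of its support. -/
lemma integral_inv_sub_arc {a b x : ℝ} (hab : a < b) (hx : b < x) :
    ∫ θ in (0 : ℝ)..Real.pi, (x - arc a b θ)⁻¹ = Real.pi / √((x - a) * (x - b)) := by
  have h := integral_inv_arc (a := x - b) (b := x - a) (by linarith) (by linarith)
  have h2 := intervalIntegral.integral_comp_sub_left (a := 0) (b := Real.pi)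
    (fun θ => √((x - b) * (x - a)) / arc (x - b) (x - a) θ) Real.pi
  rw [sub_self, sub_zero, h] at h2
  have hw : √((x - a) * (x - b)) ≠ 0 :=
    (Real.sqrt_pos.2 (mul_pos (by linarith) (by linarith))).ne'
  rw [eq_div_iff hw, mul_comm, ← intervalIntegral.integral_const_mul]
  refine Eq.trans ?_ h2
  refine intervalIntegral.integral_congr fun θ _ => ?_
  rw [mul_comm (x - b), div_eq_mul_inv, arc, arc, Real.cos_pi_sub]
  congr 2
  ring

/-- The Stieltjes transform of the arcsine law to the left of its support. -/
lemma integral_inv_sub_arc_of_lt {a b x : ℝ} (hab : a < b) (hx : x < a) :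
    ∫ θ in (0 : ℝ)..Real.pi, (x - arc a b θ)⁻¹ = -(Real.pi / √((a - x) * (b - x))) := by
  have h := integral_inv_arc (a := a - x) (b := b - x) (by linarith) (by linarith)
  have hw : √((a - x) * (b - x)) ≠ 0 :=
    (Real.sqrt_pos.2 (mul_pos (by linarith) (by linarith))).ne'
  rw [← neg_div, eq_div_iff hw, mul_comm, ← intervalIntegral.integral_const_mul]
  refine Eq.trans ?_ (congrArg Neg.neg h)
  rw [← intervalIntegral.integral_neg]
  refine intervalIntegral.integral_congr fun θ _ => ?_
  rw [div_eq_mul_inv, ← mul_neg, ← inv_neg, arc, arc]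
  congr 2
  ring

/-- The product of `π * √((y - a) * (b - y))` and the equilibrium density. -/
noncomputable def arcNum (α a b y : ℝ) : ℝ :=
  (b - y) * (y + (b - a) / 2 - α * √(a / b) / y)

/-- The equilibrium measure. -/
noncomputable def eqMeasure (α a b : ℝ) : Measure ℝ :=
  volume.withDensity fun y => ENNReal.ofReal ((Ioo a b).indicator (densF α a b) y)

lemma sqrt_div_eq {a b : ℝ} (ha : 0 < a) (hab : a < b) : √(a / b) = a / √(a * b) := by
  have hb := ha.trans hab
  rw [eq_div_iff (Real.sqrt_pos.2 (mul_pos ha hb)).ne', ← Real.sqrt_mul (div_pos ha hb).le,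
    show a / b * (a * b) = a ^ 2 by field_simp, Real.sqrt_sq ha.le]

lemma sqrt_div_mul {a b : ℝ} (ha : 0 < a) (hab : a < b) : √(a / b) * b = √(a * b) := by
  have hb := ha.trans hab
  nth_rewrite 2 [← Real.sqrt_sq hb.le]
  rw [← Real.sqrt_mul (div_pos ha hb).le]
  congr 1
  field_simp

lemma phiFun_eq {α a b : ℝ} (ha : 0 < a) (hab : a < b) :
    phiFun α b a = 2 * (a + (b - a) / 2 - α * √(a / b) / a) := by
  rw [phiFun, sqrt_div_eq ha hab]
  have := (Real.sqrt_pos.2 (mul_pos ha (ha.trans hab))).ne'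
  field_simp
  ring

lemma nonneg_of_phiFun_nonneg {α a b y : ℝ} (hα : 0 ≤ α) (ha : 0 < a) (hab : a < b)
    (hφ : 0 ≤ phiFun α b a) (hy : a ≤ y) : 0 ≤ y + (b - a) / 2 - α * √(a / b) / y := by
  rw [phiFun_eq ha hab] at hφ
  have : α * √(a / b) / y ≤ α * √(a / b) / a := by gcongr
  linarith

lemma nonpos_of_phiFun_eq_zero {α a b y : ℝ} (hα : 0 ≤ α) (ha : 0 < a) (hab : a < b)
    (hφ : phiFun α b a = 0) (hy0 : 0 < y) (hy : y ≤ a) :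
    y + (b - a) / 2 - α * √(a / b) / y ≤ 0 := by
  rw [phiFun_eq ha hab] at hφ
  have : α * √(a / b) / a ≤ α * √(a / b) / y := by gcongr
  linarith

lemma densF_eq (α a b y : ℝ) : densF α a b y =
    1 / Real.pi * √((b - y) / (y - a)) * (y + (b - a) / 2 - α * √(a / b) / y) := by
  rw [densF]
  ring

lemma densF_nonneg {α a b y : ℝ} (hα : 0 ≤ α) (ha : 0 < a) (hab : a < b)
    (hφ : 0 ≤ phiFun α b a) (hy : a ≤ y) : 0 ≤ densF α a b y := by
  rw [densF_eq]
  exact mul_nonneg (by positivity) (nonneg_of_phiFun_nonneg hα ha hab hφ hy)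

lemma indicator_densF_nonneg {α a b : ℝ} (hα : 0 ≤ α) (ha : 0 < a) (hab : a < b)
    (hφ : 0 ≤ phiFun α b a) (y : ℝ) : 0 ≤ (Ioo a b).indicator (densF α a b) y :=
  indicator_nonneg (fun _ hz => densF_nonneg hα ha hab hφ hz.1.le) y

lemma sqrt_mul_densF {α a b y : ℝ} (hy : y ∈ Ioo a b) :
    √((y - a) * (b - y)) * densF α a b y = arcNum α a b y / Real.pi := by
  have h1 : 0 < y - a := sub_pos.2 hy.1
  have h2 : 0 < b - y := sub_pos.2 hy.2
  have : √((y - a) * (b - y)) * √((b - y) / (y - a)) = b - y := by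
    rw [← Real.sqrt_mul (mul_pos h1 h2).le,
      show (y - a) * (b - y) * ((b - y) / (y - a)) = (b - y) ^ 2 by field_simp,
      Real.sqrt_sq h2.le]
  rw [densF_eq, arcNum]
  linear_combination (y + (b - a) / 2 - α * √(a / b) / y) / Real.pi * this

@[fun_prop]
lemma measurable_densF {α a b : ℝ} : Measurable (densF α a b) := by
  unfold densF; fun_prop

lemma measurable_indicator_densF {α a b : ℝ} : Measurable ((Ioo a b).indicator (densF α a b)) :=
  measurable_densF.indicator measurableSet_Ioo

lemma indicator_smul_eq (α a b : ℝ) (g : ℝ → ℝ) :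
    (fun y => (Ioo a b).indicator (densF α a b) y • g y) =
      (Ioo a b).indicator fun y => densF α a b y * g y := by
  ext y
  by_cases hy : y ∈ Ioo a b <;> simp [hy]

lemma integral_eqMeasure_eq {α a b : ℝ} (hα : 0 ≤ α) (ha : 0 < a) (hab : a < b)
    (hφ : 0 ≤ phiFun α b a) (g : ℝ → ℝ) :
    ∫ y, g y ∂(eqMeasure α a b) = ∫ y in Ioo a b, densF α a b y * g y := by
  rw [eqMeasure, integral_withDensity_eq_integral_toReal_smul
    measurable_indicator_densF.ennreal_ofReal (by simp)]
  simp only [ENNReal.toReal_ofReal (indicator_densF_nonneg hα ha hab hφ _)]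
  rw [indicator_smul_eq, integral_indicator measurableSet_Ioo]

lemma integrable_eqMeasure_iff_integrableOn {α a b : ℝ} (hα : 0 ≤ α) (ha : 0 < a) (hab : a < b)
    (hφ : 0 ≤ phiFun α b a) (g : ℝ → ℝ) :
    Integrable g (eqMeasure α a b) ↔ IntegrableOn (fun y => densF α a b y * g y) (Ioo a b) := by
  rw [eqMeasure, integrable_withDensity_iff_integrable_smul'
    measurable_indicator_densF.ennreal_ofReal (by simp)]
  simp only [ENNReal.toReal_ofReal (indicator_densF_nonneg hα ha hab hφ _)]
  rw [indicator_smul_eq, integrable_indicator_iff measurableSet_Ioo]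

lemma sqrt_mul_densF_arc {α a b : ℝ} (hab : a < b) (g : ℝ → ℝ) {θ : ℝ} (hθ : θ ∈ Ioo 0 Real.pi) :
    √((arc a b θ - a) * (b - arc a b θ)) * (densF α a b (arc a b θ) * g (arc a b θ)) =
      arcNum α a b (arc a b θ) / Real.pi * g (arc a b θ) := by
  rw [← mul_assoc, sqrt_mul_densF (arc_mem_Ioo hab hθ)]

lemma integral_eqMeasure {α a b : ℝ} (hα : 0 ≤ α) (ha : 0 < a) (hab : a < b)
    (hφ : 0 ≤ phiFun α b a) (g : ℝ → ℝ) :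
    ∫ y, g y ∂(eqMeasure α a b) =
      ∫ θ in (0 : ℝ)..Real.pi, arcNum α a b (arc a b θ) / Real.pi * g (arc a b θ) := by
  rw [integral_eqMeasure_eq hα ha hab hφ, integral_arc hab, intervalIntegral_zero_pi]
  exact setIntegral_congr_fun measurableSet_Ioo fun θ hθ => sqrt_mul_densF_arc hab g hθ

lemma integrable_eqMeasure_iff {α a b : ℝ} (hα : 0 ≤ α) (ha : 0 < a) (hab : a < b)
    (hφ : 0 ≤ phiFun α b a) (g : ℝ → ℝ) : Integrable g (eqMeasure α a b) ↔
      IntervalIntegrable (fun θ => arcNum α a b (arc a b θ) / Real.pi * g (arc a b θ))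
        volume 0 Real.pi := by
  rw [integrable_eqMeasure_iff_integrableOn hα ha hab hφ, integrableOn_arc hab,
    intervalIntegrable_iff_integrableOn_Ioo_of_le Real.pi_pos.le]
  exact integrableOn_congr_fun (fun θ hθ => sqrt_mul_densF_arc hab g hθ) measurableSet_Ioo

lemma arc_pos {a b : ℝ} (ha : 0 < a) (hab : a < b) (θ : ℝ) : 0 < arc a b θ :=
  ha.trans_le (arc_mem_Icc hab.le θ).1

lemma continuous_arcNum_arc {α a b : ℝ} (ha : 0 < a) (hab : a < b) :
    Continuous fun θ => arcNum α a b (arc a b θ) / Real.pi := by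
  unfold arcNum
  have : ∀ θ, arc a b θ ≠ 0 := fun θ => (arc_pos ha hab θ).ne'
  fun_prop (disch := assumption)

lemma continuous_div_arc {a b : ℝ} (ha : 0 < a) (hab : a < b) (c : ℝ) :
    Continuous fun θ => c / arc a b θ := by
  have : ∀ θ, arc a b θ ≠ 0 := fun θ => (arc_pos ha hab θ).ne'
  fun_prop (disch := assumption)

lemma arcNum_arc {α a b : ℝ} (ha : 0 < a) (hab : a < b) (hψ : psiFun α b a = 0) (θ : ℝ) :
    arcNum α a b (arc a b θ) / Real.pi = ((1 + α)
      - (b ^ 2 - a ^ 2) / 4 * Real.cos θ - (b - a) ^ 2 / 8 * Real.cos (2 * θ)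
      - α * (√(a * b) / arc a b θ)) / Real.pi := by
  have h0 := (arc_pos ha hab θ).ne'
  have hψ' : (3 / 4) * (b - a) ^ 2 + a * (b - a) + 2 * α * √(a / b) - 2 * α - 2 = 0 := by
    rw [← hψ, psiFun, Real.sqrt_div ha.le]; ring
  congr 1
  rw [arcNum, ← sqrt_div_mul ha hab, Real.cos_two_mul]
  have e : α * √(a / b) / arc a b θ * arc a b θ = α * √(a / b) := by field_simp
  have e2 : α * (√(a / b) * b / arc a b θ) = b * (α * √(a / b) / arc a b θ) := by ring
  rw [e2]
  generalize α * √(a / b) / arc a b θ = q at *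
  rw [arc] at *
  linear_combination e + hψ' / 2

lemma integral_eqMeasure_one {α a b : ℝ} (hα : 0 ≤ α) (ha : 0 < a) (hab : a < b)
    (hφ : 0 ≤ phiFun α b a) (hψ : psiFun α b a = 0) :
    ∫ _, (1 : ℝ) ∂(eqMeasure α a b) = 1 := by
  have i1 := (continuous_div_arc ha hab √(a * b)).intervalIntegrable (μ := volume) 0 Real.pi
  rw [integral_eqMeasure hα ha hab hφ]
  simp only [arcNum_arc ha hab hψ, mul_one]
  rw [intervalIntegral.integral_div, intervalIntegral.integral_sub _ (i1.const_mul _),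
    intervalIntegral.integral_sub, intervalIntegral.integral_sub]
  · simp only [intervalIntegral.integral_const_mul, integral_inv_arc ha hab, integral_cos_zero_pi,
      integral_cos_two_mul_zero_pi, intervalIntegral.integral_const, smul_eq_mul]
    field_simp [Real.pi_ne_zero]
    ring
  all_goals exact Continuous.intervalIntegrable (by fun_prop) _ _

lemma isProbabilityMeasure_eqMeasure {α a b : ℝ} (hα : 0 ≤ α) (ha : 0 < a) (hab : a < b)
    (hφ : 0 ≤ phiFun α b a) (hψ : psiFun α b a = 0) :
    IsProbabilityMeasure (eqMeasure α a b) := by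
  have := integral_eqMeasure_one hα ha hab hφ hψ
  rw [integral_const, smul_eq_mul, mul_one] at this
  exact ⟨(ENNReal.toReal_eq_one_iff _).1 this⟩

lemma ae_mem_eqMeasure (α a b : ℝ) : ∀ᵐ y ∂(eqMeasure α a b), y ∈ Ioo a b := by
  rw [eqMeasure, ae_withDensity_iff measurable_indicator_densF.ennreal_ofReal]
  refine Eventually.of_forall fun y hy => ?_
  by_contra h
  simp [h] at hy

lemma integrable_log_eqMeasure {α a b : ℝ} (hα : 0 ≤ α) (ha : 0 < a) (hab : a < b)
    (hφ : 0 ≤ phiFun α b a) (x : ℝ) :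
    Integrable (fun y => Real.log (x - y)) (eqMeasure α a b) := by
  rw [integrable_eqMeasure_iff hα ha hab hφ]
  simpa only [mul_comm] using
    intervalIntegrable_log_sub_arc hab x (continuous_arcNum_arc (α := α) ha hab)

lemma logPot_eqMeasure {α a b t : ℝ} (hα : 0 ≤ α) (ha : 0 < a) (hab : a < b)
    (hφ : 0 ≤ phiFun α b a) (hψ : psiFun α b a = 0) (ht : t ∈ Icc 0 Real.pi) :
    logPot (eqMeasure α a b) (arc a b t) =
      (1 + α) * (Real.log (b - a) - 2 * Real.log 2) + (b ^ 2 - a ^ 2) / 4 * Real.cos t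
        + (b - a) ^ 2 / 16 * Real.cos (2 * t) - α * Real.log (arc a b t)
        - α * ((Real.log (a⁻¹ - b⁻¹) - 2 * Real.log 2) -
          (∫ θ in (0 : ℝ)..Real.pi, Real.log (arc b⁻¹ a⁻¹ θ)) / Real.pi) := by
  have i : ∀ {F : ℝ → ℝ}, Continuous F → IntervalIntegrable
      (fun θ => Real.log (arc a b t - arc a b θ) * F θ) volume 0 Real.pi := fun hF =>
    intervalIntegrable_log_sub_arc hab _ hF
  have hx : arc a b t ∈ Icc a b := arc_mem_Icc hab.le t
  have i1 := i (F := fun _ => 1) (by fun_prop)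
  simp only [mul_one] at i1
  have i2 := i (F := fun θ => Real.cos θ) (by fun_prop)
  have i3 := i (F := fun θ => Real.cos (2 * θ)) (by fun_prop)
  have i4 := i (continuous_div_arc ha hab √(a * b))
  have e : ∀ θ, ((1 + α) - (b ^ 2 - a ^ 2) / 4 * Real.cos θ - (b - a) ^ 2 / 8 * Real.cos (2 * θ)
      - α * (√(a * b) / arc a b θ)) / Real.pi * Real.log (arc a b t - arc a b θ) =
      ((1 + α) * Real.log (arc a b t - arc a b θ)
        - (b ^ 2 - a ^ 2) / 4 * (Real.log (arc a b t - arc a b θ) * Real.cos θ)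
        - (b - a) ^ 2 / 8 * (Real.log (arc a b t - arc a b θ) * Real.cos (2 * θ))
        - α * (Real.log (arc a b t - arc a b θ) * (√(a * b) / arc a b θ))) / Real.pi :=
    fun θ => by ring
  rw [logPot, integral_eqMeasure hα ha hab hφ]
  simp only [arcNum_arc ha hab hψ, e]
  rw [intervalIntegral.integral_div, intervalIntegral.integral_sub
    (((i1.const_mul _).sub (i2.const_mul _)).sub (i3.const_mul _)) (i4.const_mul _),
    intervalIntegral.integral_sub ((i1.const_mul _).sub (i2.const_mul _)) (i3.const_mul _),
    intervalIntegral.integral_sub (i1.const_mul _) (i2.const_mul _)]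
  simp only [intervalIntegral.integral_const_mul, integral_log_sub_arc hab hx,
    integral_log_sub_arc_mul_cos hab ht, integral_log_sub_arc_mul_cos_two_mul hab ht,
    integral_log_sub_arc_div ha hab hx]
  have := Real.pi_ne_zero
  field_simp
  ring

lemma effPot_eqMeasure {α a b x : ℝ} (hα : 0 ≤ α) (ha : 0 < a) (hab : a < b)
    (hφ : 0 ≤ phiFun α b a) (hψ : psiFun α b a = 0) (hx : x ∈ Icc a b) :
    effPot (eqMeasure α a b) α x =
      ((a + b) ^ 2 / 4 + (b - a) ^ 2 / 8) - 2 * ((1 + α) * (Real.log (b - a) - 2 * Real.log 2))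
        + 2 * (α * ((Real.log (a⁻¹ - b⁻¹) - 2 * Real.log 2) -
          (∫ θ in (0 : ℝ)..Real.pi, Real.log (arc b⁻¹ a⁻¹ θ)) / Real.pi)) := by
  obtain ⟨t, ht, rfl⟩ := exists_arc_eq hab hx
  rw [effPot, logPot_eqMeasure hα ha hab hφ hψ ht, Real.cos_two_mul]
  have : arc a b t ^ 2 = ((a + b) / 2 + (b - a) / 2 * Real.cos t) ^ 2 := rfl
  rw [this]
  ring

lemma logReg_sub_log_le {ε u κ s : ℝ} (hε : 0 < ε) (hκ : 0 < κ) (hs : s ≠ 0)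
    (hu : κ * s ^ 2 ≤ |u|) :
    logReg ε u - Real.log u ≤
      4 * (κ ^ (-(1 / 4) : ℝ) * |s| ^ (-(1 / 2) : ℝ)) * ε ^ (1 / 4 : ℝ) := by
  have hs' : 0 < |s| := abs_pos.2 hs
  have hu0 : 0 < |u| := (by positivity : 0 < κ * s ^ 2).trans_le hu
  set w := κ ^ (-(1 / 4) : ℝ) * |s| ^ (-(1 / 2) : ℝ) * ε ^ (1 / 4 : ℝ) with hw
  have hw0 : 0 < w := by positivity
  have h4 : w ^ 4 = (κ * s ^ 2)⁻¹ * ε := by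
    rw [hw, mul_pow, mul_pow, ← Real.rpow_mul_natCast hκ.le, ← Real.rpow_mul_natCast hs'.le,
      ← Real.rpow_mul_natCast hε.le]
    norm_num
    rw [Real.rpow_neg_one]
    exact Or.inl (mul_comm _ _)
  have h5 : ε ≤ |u| * w ^ 4 := by
    rw [h4]
    calc ε = (κ * s ^ 2) * ((κ * s ^ 2)⁻¹ * ε) := by field_simp
      _ ≤ _ := by gcongr
  have h6 : logReg ε u ≤ Real.log (|u| * (1 + w) ^ 4) := by
    rw [logReg, div_le_iff₀ two_pos, mul_comm, ← Real.log_rpow (by positivity)]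
    refine Real.log_le_log (by positivity) ?_
    rw [Real.rpow_two, ← sq_abs u]
    have h7 : |u| + ε ≤ |u| * (1 + w) ^ 4 := by
      have : 1 + w ^ 4 ≤ (1 + w) ^ 4 := by nlinarith [pow_pos hw0 2, pow_pos hw0 3]
      nlinarith
    calc |u| ^ 2 + ε ^ 2 ≤ (|u| + ε) ^ 2 := by nlinarith
      _ ≤ _ := by gcongr
  rw [Real.log_mul hu0.ne' (by positivity), Real.log_abs, Real.log_pow] at h6
  have h8 := Real.log_le_sub_one_of_pos (show 0 < 1 + w by linarith)
  push_cast at h6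
  rw [mul_assoc, ← hw]
  linarith

lemma sq_sub_le_abs_cos_sub_cos {t θ : ℝ} (ht : t ∈ Icc 0 Real.pi) (hθ : θ ∈ Icc 0 Real.pi) :
    2 / Real.pi ^ 2 * (θ - t) ^ 2 ≤ |Real.cos t - Real.cos θ| := by
  have h1 : |(θ - t) / 2| ≤ Real.pi / 2 := by
    rw [abs_le]; constructor <;> linarith [ht.1, ht.2, hθ.1, hθ.2]
  have h2 := Real.mul_abs_le_abs_sin h1
  have h3 : |Real.sin ((θ - t) / 2)| ≤ |Real.sin ((θ + t) / 2)| := by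
    rw [← sq_le_sq]
    have h4 := mul_nonneg (Real.sin_nonneg_of_nonneg_of_le_pi ht.1 ht.2)
      (Real.sin_nonneg_of_nonneg_of_le_pi hθ.1 hθ.2)
    have e1 : Real.sin t = Real.sin ((θ + t) / 2 - (θ - t) / 2) := by ring_nf
    have e2 : Real.sin θ = Real.sin ((θ + t) / 2 + (θ - t) / 2) := by ring_nf
    rw [e1, e2, Real.sin_sub, Real.sin_add] at h4
    nlinarith [Real.sin_sq_add_cos_sq ((θ + t) / 2), Real.sin_sq_add_cos_sq ((θ - t) / 2)]
  rw [sum_half_angle, abs_mul, abs_mul, abs_two]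
  calc 2 / Real.pi ^ 2 * (θ - t) ^ 2 = 2 * ((2 / Real.pi * |(θ - t) / 2|) *
        (2 / Real.pi * |(θ - t) / 2|)) := by
        rw [mul_mul_mul_comm, abs_mul_abs_self]; ring
    _ ≤ 2 * (|Real.sin ((θ - t) / 2)| * |Real.sin ((θ - t) / 2)|) := by gcongr
    _ ≤ _ := by gcongr

lemma exists_sq_le_abs_sub_arc {a b : ℝ} (hab : a < b) (x : ℝ) :
    ∃ t ∈ Icc 0 Real.pi, ∀ θ ∈ Icc 0 Real.pi,
      (b - a) / Real.pi ^ 2 * (θ - t) ^ 2 ≤ |x - arc a b θ| := by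
  suffices ∃ t ∈ Icc 0 Real.pi, ∀ θ, |arc a b t - arc a b θ| ≤ |x - arc a b θ| by
    obtain ⟨t, ht, h⟩ := this
    refine ⟨t, ht, fun θ hθ => le_trans ?_ (h θ)⟩
    rw [arc_sub_arc, abs_mul, abs_of_pos (by linarith : 0 < (b - a) / 2)]
    have := mul_le_mul_of_nonneg_left (sq_sub_le_abs_cos_sub_cos ht hθ)
      (by linarith : 0 ≤ (b - a) / 2)
    refine le_trans (le_of_eq ?_) this
    ring
  have hm := fun θ => arc_mem_Icc hab.le θ
  rcases lt_or_ge x a with h1 | h1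
  · refine ⟨Real.pi, ⟨Real.pi_pos.le, le_rfl⟩, fun θ => ?_⟩
    have : arc a b Real.pi = a := by rw [arc, Real.cos_pi]; ring
    rw [this, abs_of_nonpos (by linarith [(hm θ).1]), abs_of_nonpos (by linarith [(hm θ).1])]
    linarith
  rcases lt_or_ge b x with h2 | h2
  · refine ⟨0, ⟨le_rfl, Real.pi_pos.le⟩, fun θ => ?_⟩
    have : arc a b 0 = b := by rw [arc, Real.cos_zero]; ring
    rw [this, abs_of_nonneg (by linarith [(hm θ).2]), abs_of_nonneg (by linarith [(hm θ).2])]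
    linarith
  · obtain ⟨t, ht, rfl⟩ := exists_arc_eq hab ⟨h1, h2⟩
    exact ⟨t, ht, fun θ => le_rfl⟩

lemma intervalIntegrable_abs_rpow (c d : ℝ) :
    IntervalIntegrable (fun s : ℝ => |s| ^ (-(1 / 2) : ℝ)) volume c d := by
  refine intervalIntegrable_of_even (fun s => by rw [abs_neg]) fun s hs => ?_
  refine (intervalIntegral.intervalIntegrable_rpow' (r := -(1 / 2)) (by norm_num)).congr ?_
  intro u hu
  rw [uIoc_of_le hs.le] at hu
  simp only [abs_of_pos hu.1]

lemma integral_abs_sub_rpow_le {t : ℝ} (ht : t ∈ Icc 0 Real.pi) :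
    ∫ θ in (0 : ℝ)..Real.pi, |θ - t| ^ (-(1 / 2) : ℝ) ≤
      ∫ s in (-Real.pi)..Real.pi, |s| ^ (-(1 / 2) : ℝ) := by
  rw [intervalIntegral.integral_comp_sub_right (fun s => |s| ^ (-(1 / 2) : ℝ)) t]
  refine intervalIntegral.integral_mono_interval (by linarith [ht.2]) (by linarith [Real.pi_pos])
    (by linarith [ht.1]) (ae_of_all _ fun s => by positivity) (intervalIntegrable_abs_rpow _ _)

lemma arcNum_div_nonneg {α a b : ℝ} (hα : 0 ≤ α) (ha : 0 < a) (hab : a < b)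
    (hφ : 0 ≤ phiFun α b a) (θ : ℝ) : 0 ≤ arcNum α a b (arc a b θ) / Real.pi := by
  have h := arc_mem_Icc hab.le θ
  exact div_nonneg (mul_nonneg (sub_nonneg.2 h.2) (nonneg_of_phiFun_nonneg hα ha hab hφ h.1))
    Real.pi_pos.le

lemma exists_arcNum_le {α a b : ℝ} (ha : 0 < a) (hab : a < b) :
    ∃ M, 0 ≤ M ∧ ∀ θ ∈ Icc 0 Real.pi, arcNum α a b (arc a b θ) / Real.pi ≤ M := by
  obtain ⟨M, hM⟩ := isCompact_Icc.exists_bound_of_continuousOn (s := Icc 0 Real.pi)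
    (continuous_arcNum_arc (α := α) ha hab).continuousOn
  exact ⟨M, (norm_nonneg _).trans (hM 0 ⟨le_rfl, Real.pi_pos.le⟩),
    fun θ hθ => (le_abs_self _).trans (hM θ hθ)⟩

lemma continuous_logReg_sub_arc {ε a b : ℝ} (hε : 0 < ε) :
    Continuous fun p : ℝ × ℝ => logReg ε (p.1 - arc a b p.2) :=
  (continuous_logReg hε).comp (by fun_prop)

lemma exists_logReg_sub_logPot_le {α a b : ℝ} (hα : 0 ≤ α) (ha : 0 < a) (hab : a < b)
    (hφ : 0 ≤ phiFun α b a) : ∃ C, ∀ x ε, 0 < ε →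
      |∫ y, logReg ε (x - y) ∂(eqMeasure α a b) - logPot (eqMeasure α a b) x| ≤
        C * ε ^ (1 / 4 : ℝ) := by
  obtain ⟨M, hM0, hM⟩ := exists_arcNum_le (α := α) ha hab
  have hκ : 0 < (b - a) / Real.pi ^ 2 := div_pos (by linarith) (by positivity)
  set κ := (b - a) / Real.pi ^ 2
  refine ⟨M * (4 * κ ^ (-(1 / 4) : ℝ)) * ∫ s in (-Real.pi)..Real.pi, |s| ^ (-(1 / 2) : ℝ),
    fun x ε hε => ?_⟩
  obtain ⟨t, ht, hx⟩ := exists_sq_le_abs_sub_arc hab x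
  have i1 : IntervalIntegrable (fun θ => arcNum α a b (arc a b θ) / Real.pi *
      logReg ε (x - arc a b θ)) volume 0 Real.pi :=
    ((continuous_arcNum_arc ha hab).mul ((continuous_logReg hε).comp
      (by fun_prop))).intervalIntegrable _ _
  have i2 := (integrable_eqMeasure_iff hα ha hab hφ _).1 (integrable_log_eqMeasure hα ha hab hφ x)
  have i3 : IntervalIntegrable (fun θ => |θ - t| ^ (-(1 / 2) : ℝ)) volume 0 Real.pi := by
    have := (intervalIntegrable_abs_rpow (0 - t) (Real.pi - t)).comp_sub_right t
    simpa using this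
  have hne : ∀ᵐ θ ∂(volume.restrict (Icc 0 Real.pi)), θ ≠ t ∧ θ ∈ Icc 0 Real.pi := by
    filter_upwards [ae_restrict_of_ae (compl_mem_ae_iff.2 (by simp : volume ({t} : Set ℝ) = 0)),
      ae_restrict_mem measurableSet_Icc] with θ h1 h2 using ⟨h1, h2⟩
  rw [logPot, integral_eqMeasure hα ha hab hφ, integral_eqMeasure hα ha hab hφ,
    ← intervalIntegral.integral_sub i1 i2, abs_of_nonneg]
  · calc _ ≤ ∫ θ in (0 : ℝ)..Real.pi, M * (4 * κ ^ (-(1 / 4) : ℝ)) * ε ^ (1 / 4 : ℝ) *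
          |θ - t| ^ (-(1 / 2) : ℝ) := by
          refine intervalIntegral.integral_mono_ae_restrict Real.pi_pos.le (i1.sub i2)
            (i3.const_mul _) ?_
          filter_upwards [hne] with θ ⟨h1, h2⟩
          have := logReg_sub_log_le hε hκ (sub_ne_zero.2 h1) (hx θ h2)
          calc _ = arcNum α a b (arc a b θ) / Real.pi *
                (logReg ε (x - arc a b θ) - Real.log (x - arc a b θ)) := by ring
            _ ≤ arcNum α a b (arc a b θ) / Real.pi *
                (4 * (κ ^ (-(1 / 4) : ℝ) * |θ - t| ^ (-(1 / 2) : ℝ)) * ε ^ (1 / 4 : ℝ)) :=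
              mul_le_mul_of_nonneg_left this (arcNum_div_nonneg hα ha hab hφ θ)
            _ ≤ M * (4 * (κ ^ (-(1 / 4) : ℝ) * |θ - t| ^ (-(1 / 2) : ℝ)) * ε ^ (1 / 4 : ℝ)) :=
              mul_le_mul_of_nonneg_right (hM θ h2) (by positivity)
            _ = _ := by ring
      _ = M * (4 * κ ^ (-(1 / 4) : ℝ)) * ε ^ (1 / 4 : ℝ) *
          ∫ θ in (0 : ℝ)..Real.pi, |θ - t| ^ (-(1 / 2) : ℝ) :=
        intervalIntegral.integral_const_mul _ _
      _ ≤ M * (4 * κ ^ (-(1 / 4) : ℝ)) * ε ^ (1 / 4 : ℝ) *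
          ∫ s in (-Real.pi)..Real.pi, |s| ^ (-(1 / 2) : ℝ) := by
        gcongr
        exact integral_abs_sub_rpow_le ht
      _ = _ := by ring
  · refine intervalIntegral.integral_nonneg_of_ae_restrict Real.pi_pos.le ?_
    filter_upwards [hne] with θ ⟨h1, h2⟩
    have h3 : x - arc a b θ ≠ 0 := abs_pos.1
      ((mul_pos hκ (pow_two_pos_of_ne_zero (sub_ne_zero.2 h1))).trans_le (hx θ h2))
    rw [Pi.zero_apply, ← mul_sub]
    exact mul_nonneg (arcNum_div_nonneg hα ha hab hφ θ) (sub_nonneg.2 (log_le_logReg h3 ε))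

lemma continuous_logPot_eqMeasure {α a b : ℝ} (hα : 0 ≤ α) (ha : 0 < a) (hab : a < b)
    (hφ : 0 ≤ phiFun α b a) : Continuous (logPot (eqMeasure α a b)) := by
  obtain ⟨C, hC⟩ := exists_logReg_sub_logPot_le hα ha hab hφ
  refine continuous_of_uniform_approx_of_continuous fun u hu => ?_
  obtain ⟨δ, hδ, hδu⟩ := Metric.mem_uniformity_dist.1 hu
  have hlim : Tendsto (fun ε : ℝ => C * ε ^ (1 / 4 : ℝ)) (𝓝[>] 0) (𝓝 0) := by
    have h := ((Real.continuousAt_rpow_const 0 (1 / 4 : ℝ) (Or.inr (by norm_num))).const_mul C)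
    have h2 := h.tendsto
    rw [Real.zero_rpow (by norm_num), mul_zero] at h2
    exact h2.mono_left nhdsWithin_le_nhds
  obtain ⟨ε, hε1, hε2⟩ := ((hlim.eventually (gt_mem_nhds hδ)).and self_mem_nhdsWithin).exists
  have hε : 0 < ε := hε2
  refine ⟨fun x => ∫ y, logReg ε (x - y) ∂(eqMeasure α a b), ?_, fun x => hδu ?_⟩
  · simp only [integral_eqMeasure hα ha hab hφ]
    refine intervalIntegral.continuous_parametric_intervalIntegral_of_continuous' ?_ _ _
    exact ((continuous_arcNum_arc ha hab).comp continuous_snd).mul (continuous_logReg_sub_arc hε)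
  · rw [dist_comm, Real.dist_eq]
    exact (hC x ε hε).trans_lt hε1

lemma hasDerivAt_logPot_eqMeasure {α a b x : ℝ} (hα : 0 ≤ α) (ha : 0 < a) (hab : a < b)
    (hφ : 0 ≤ phiFun α b a) (hx : x ∉ Icc a b) :
    HasDerivAt (logPot (eqMeasure α a b))
      (∫ θ in (0 : ℝ)..Real.pi, arcNum α a b (arc a b θ) / Real.pi * (x - arc a b θ)⁻¹) x := by
  obtain ⟨δ, hδ, hball⟩ := Metric.isOpen_iff.1 isClosed_Icc.isOpen_compl x hx
  obtain ⟨M, hM0, hM⟩ := exists_arcNum_le (α := α) ha hab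
  have hc := continuous_arcNum_arc (α := α) ha hab
  have hfar : ∀ z ∈ Metric.ball x (δ / 2), ∀ θ, δ / 2 ≤ |z - arc a b θ| := by
    intro z hz θ
    have h1 : δ ≤ |x - arc a b θ| := by
      by_contra! h
      refine hball (a := arc a b θ) ?_ (arc_mem_Icc hab.le θ)
      rwa [Metric.mem_ball, dist_comm, Real.dist_eq]
    rw [Metric.mem_ball, dist_comm, Real.dist_eq] at hz
    have := abs_sub_le x z (arc a b θ)
    linarith
  have hne : ∀ z ∈ Metric.ball x (δ / 2), ∀ θ, z - arc a b θ ≠ 0 := fun z hz θ =>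
    abs_pos.1 ((half_pos hδ).trans_le (hfar z hz θ))
  have hnhds : Metric.ball x (δ / 2) ∈ 𝓝 x := Metric.ball_mem_nhds x (half_pos hδ)
  have hxmem : x ∈ Metric.ball x (δ / 2) := Metric.mem_ball_self (half_pos hδ)
  have hlog : ∀ z ∈ Metric.ball x (δ / 2), Continuous fun θ =>
      arcNum α a b (arc a b θ) / Real.pi * Real.log (z - arc a b θ) := fun z hz =>
    hc.mul (Continuous.log (by fun_prop) (hne z hz))
  have key := intervalIntegral.hasDerivAt_integral_of_dominated_loc_of_deriv_le
    (μ := volume) (a := 0) (b := Real.pi) (bound := fun _ => M * (δ / 2)⁻¹)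
    (F := fun z θ => arcNum α a b (arc a b θ) / Real.pi * Real.log (z - arc a b θ))
    (F' := fun z θ => arcNum α a b (arc a b θ) / Real.pi * (z - arc a b θ)⁻¹) hnhds
    (by filter_upwards [hnhds] with z hz using (hlog z hz).aestronglyMeasurable)
    ((hlog x hxmem).intervalIntegrable _ _)
    (hc.mul (Continuous.inv₀ (by fun_prop) (hne x hxmem))).aestronglyMeasurable
    (ae_of_all _ fun θ hθ z hz => ?_) (by simp) (ae_of_all _ fun θ hθ z hz => ?_)
  · refine key.2.congr_of_eventuallyEq (Eventually.of_forall fun z => ?_)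
    rw [logPot, integral_eqMeasure hα ha hab hφ]
  · rw [uIoc_of_le Real.pi_pos.le] at hθ
    rw [Real.norm_eq_abs, abs_mul, abs_inv, abs_of_nonneg (arcNum_div_nonneg hα ha hab hφ θ)]
    have h1 := half_pos hδ
    exact mul_le_mul (hM θ (Ioc_subset_Icc_self hθ)) (inv_anti₀ h1 (hfar z hz θ))
      (inv_nonneg.2 (abs_nonneg _)) hM0
  · have h1 := ((hasDerivAt_id z).sub_const (arc a b θ)).log (hne z hz θ)
    exact (h1.const_mul _).congr_deriv (by rw [one_div]; rfl)

lemma integral_arcNum_mul_inv {α a b x : ℝ} (ha : 0 < a) (hab : a < b) (hx0 : x ≠ 0)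
    (hx : x ∉ Icc a b) :
    ∫ θ in (0 : ℝ)..Real.pi, arcNum α a b (arc a b θ) / Real.pi * (x - arc a b θ)⁻¹ =
      arcNum α a b x * (∫ θ in (0 : ℝ)..Real.pi, (x - arc a b θ)⁻¹) / Real.pi + x - α / x := by
  have hne := sub_arc_ne_zero hab hx
  have e : ∀ θ, arcNum α a b (arc a b θ) / Real.pi * (x - arc a b θ)⁻¹ =
      (arcNum α a b x * (x - arc a b θ)⁻¹ + x + (b - a) / 2 * Real.cos θ
        - α / x * (√(a * b) / arc a b θ)) / Real.pi := by
    intro θ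
    have h1 := hne θ
    have h2 := (arc_pos ha hab θ).ne'
    have e1 : (b - a) / 2 * Real.cos θ = arc a b θ - (a + b) / 2 := by rw [arc]; ring
    rw [e1, ← sqrt_div_mul ha hab, arcNum, arcNum]
    generalize √(a / b) = s
    generalize arc a b θ = y at *
    field_simp
    ring
  have i1 : IntervalIntegrable (fun θ => (x - arc a b θ)⁻¹) volume 0 Real.pi :=
    (Continuous.inv₀ (by fun_prop) hne).intervalIntegrable _ _
  have i2 := (continuous_div_arc ha hab √(a * b)).intervalIntegrable (μ := volume) 0 Real.pi
  have i3 : IntervalIntegrable (fun θ => (b - a) / 2 * Real.cos θ) volume 0 Real.pi :=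
    Continuous.intervalIntegrable (by fun_prop) _ _
  have i4 : IntervalIntegrable (fun _ : ℝ => x) volume 0 Real.pi := by simp
  simp only [e]
  rw [intervalIntegral.integral_div,
    intervalIntegral.integral_sub (((i1.const_mul _).add i4).add i3) (i2.const_mul _),
    intervalIntegral.integral_add ((i1.const_mul _).add i4) i3,
    intervalIntegral.integral_add (i1.const_mul _) i4]
  simp only [intervalIntegral.integral_const_mul, integral_inv_arc ha hab, integral_cos_zero_pi,
    intervalIntegral.integral_const, smul_eq_mul]
  have := Real.pi_ne_zero
  field_simp
  ring

lemma hasDerivAt_effPot_eqMeasure {α a b x : ℝ} (hα : 0 ≤ α) (ha : 0 < a) (hab : a < b)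
    (hφ : 0 ≤ phiFun α b a) (hx0 : x ≠ 0) (hx : x ∉ Icc a b) :
    HasDerivAt (effPot (eqMeasure α a b) α)
      (-(2 * arcNum α a b x * (∫ θ in (0 : ℝ)..Real.pi, (x - arc a b θ)⁻¹) / Real.pi)) x := by
  have h := ((hasDerivAt_pow 2 x).sub ((Real.hasDerivAt_log hx0).const_mul (2 * α))).sub
    ((hasDerivAt_logPot_eqMeasure hα ha hab hφ hx).const_mul 2)
  refine h.congr_deriv ?_
  rw [integral_arcNum_mul_inv ha hab hx0 hx]
  push_cast
  ring

lemma continuousOn_effPot_eqMeasure {α a b : ℝ} (hα : 0 ≤ α) (ha : 0 < a) (hab : a < b)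
    (hφ : 0 ≤ phiFun α b a) : ContinuousOn (effPot (eqMeasure α a b) α) (Ioi 0) := by
  have h1 := continuous_logPot_eqMeasure hα ha hab hφ
  have h2 : ContinuousOn Real.log (Ioi 0) :=
    Real.continuousOn_log.mono fun x hx => (ne_of_gt hx : x ≠ 0)
  unfold effPot
  fun_prop

lemma monotoneOn_effPot_eqMeasure {α a b : ℝ} (hα : 0 ≤ α) (ha : 0 < a) (hab : a < b)
    (hφ : 0 ≤ phiFun α b a) : MonotoneOn (effPot (eqMeasure α a b) α) (Ici b) := by
  have hb := ha.trans hab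
  have hd : ∀ x ∈ Ioi b, HasDerivAt (effPot (eqMeasure α a b) α) _ x := fun x hx =>
    hasDerivAt_effPot_eqMeasure hα ha hab hφ (hb.trans hx).ne' fun h => h.2.not_gt hx
  refine monotoneOn_of_deriv_nonneg (convex_Ici b)
    ((continuousOn_effPot_eqMeasure hα ha hab hφ).mono fun x hx => hb.trans_le hx) ?_ ?_
  · rw [interior_Ici]
    exact fun x hx => (hd x hx).differentiableAt.differentiableWithinAt
  · rw [interior_Ici]
    intro x hx
    rw [(hd x hx).deriv, integral_inv_sub_arc hab hx]
    have h1 : arcNum α a b x ≤ 0 := mul_nonpos_of_nonpos_of_nonneg (sub_nonpos.2 (le_of_lt hx))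
      (nonneg_of_phiFun_nonneg hα ha hab hφ (hab.trans hx).le)
    have h2 : 0 ≤ Real.pi / √((x - a) * (x - b)) := by positivity
    rw [neg_nonneg]
    exact div_nonpos_of_nonpos_of_nonneg
      (mul_nonpos_of_nonpos_of_nonneg (by linarith) h2) Real.pi_pos.le

lemma antitoneOn_effPot_eqMeasure {α a b : ℝ} (hα : 0 ≤ α) (ha : 0 < a) (hab : a < b)
    (hφ : phiFun α b a = 0) : AntitoneOn (effPot (eqMeasure α a b) α) (Ioc 0 a) := by
  have hd : ∀ x ∈ Ioo 0 a, HasDerivAt (effPot (eqMeasure α a b) α) _ x := fun x hx =>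
    hasDerivAt_effPot_eqMeasure hα ha hab hφ.ge hx.1.ne' fun h => h.1.not_gt hx.2
  refine antitoneOn_of_deriv_nonpos (convex_Ioc 0 a)
    ((continuousOn_effPot_eqMeasure hα ha hab hφ.ge).mono fun x hx => hx.1) ?_ ?_
  · rw [interior_Ioc]
    exact fun x hx => (hd x hx).differentiableAt.differentiableWithinAt
  · rw [interior_Ioc]
    intro x hx
    rw [(hd x hx).deriv, integral_inv_sub_arc_of_lt hab hx.2]
    have h1 : arcNum α a b x ≤ 0 := mul_nonpos_of_nonneg_of_nonpos
      (by linarith [hx.2]) (nonpos_of_phiFun_eq_zero hα ha hab hφ hx.1 hx.2.le)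
    have h2 : -(Real.pi / √((a - x) * (b - x))) ≤ 0 := neg_nonpos.2 (by positivity)
    rw [neg_nonpos]
    exact div_nonneg (mul_nonneg_of_nonpos_of_nonpos (by linarith) h2) Real.pi_pos.le

lemma densF_le {α a b y : ℝ} (hα : 0 ≤ α) (ha : 0 < a) (hy : y ∈ Ioo a b) :
    densF α a b y ≤
      Real.exp (Real.log (√(b - a) * (2 * b) / Real.pi) - Real.log (a - y) / 2) := by
  have h1 : 0 < y - a := sub_pos.2 hy.1
  have hab : 0 < b - a := by linarith [hy.1, hy.2]
  have hb : 0 < b := by linarith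
  rw [← neg_sub y a, Real.log_neg_eq_log, ← Real.log_sqrt h1.le, Real.exp_sub,
    Real.exp_log (by positivity), Real.exp_log (Real.sqrt_pos.2 h1), densF_eq,
    Real.sqrt_div (by linarith [hy.2])]
  have h2 : y + (b - a) / 2 - α * √(a / b) / y ≤ 2 * b := by
    have : 0 ≤ α * √(a / b) / y := div_nonneg (by positivity) (by linarith)
    linarith [hy.2]
  calc _ ≤ 1 / Real.pi * (√(b - y) / √(y - a)) * (2 * b) := by gcongr
    _ ≤ 1 / Real.pi * (√(b - a) / √(y - a)) * (2 * b) := by gcongr; exact hy.1.le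
    _ = _ := by ring

/-- The measure with density `densF α a b` on `(a, b)` is the equilibrium measure on `[σ, ∞)`. -/
theorem exists_isEquilibrium_eqMeasure {α σ a b : ℝ} (hα : 0 ≤ α) (hσ : 0 < σ) (hσa : σ ≤ a)
    (hab : a < b) (hψ : psiFun α b a = 0) (hφ : 0 ≤ phiFun α b a)
    (hcase : a = σ ∨ phiFun α b a = 0) :
    ∃ ℓ C, IsEquilibrium (eqMeasure α a b) α σ a b ℓ C := by
  have ha : 0 < a := hσ.trans_le hσa
  obtain ⟨C, hC⟩ := exists_logReg_sub_logPot_le hα ha hab hφ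
  have hprob := isProbabilityMeasure_eqMeasure hα ha hab hφ hψ
  have hconst : ∀ x ∈ Icc a b,
      effPot (eqMeasure α a b) α x = effPot (eqMeasure α a b) α b := fun x hx => by
    rw [effPot_eqMeasure hα ha hab hφ hψ hx,
      effPot_eqMeasure hα ha hab hφ hψ ⟨hab.le, le_rfl⟩]
  refine ⟨effPot (eqMeasure α a b) α b, C, ⟨hprob, ?_, ?_, ?_, hconst, ?_, ?_⟩⟩
  · filter_upwards [ae_mem_eqMeasure α a b] with y hy using Ioo_subset_Icc_self hy
  · exact integrable_log_eqMeasure hα ha hab hφ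
  · intro x ε hε _
    linarith [(abs_le.1 (hC x ε hε)).2]
  · intro x hx
    rcases lt_or_ge x a with h1 | h1
    · have h2 : phiFun α b a = 0 := hcase.resolve_left fun h => by linarith
      rw [← hconst a ⟨le_rfl, hab.le⟩]
      exact antitoneOn_effPot_eqMeasure hα ha hab h2 ⟨hσ.trans_le hx, h1.le⟩ ⟨ha, le_rfl⟩ h1.le
    rcases le_or_gt x b with h2 | h2
    · exact (hconst x ⟨h1, h2⟩).ge
    · exact monotoneOn_effPot_eqMeasure hα ha hab hφ self_mem_Ici h2.le h2.le
  · refine ⟨(Ioo a b).indicator (densF α a b),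
      fun y => Real.log (√(b - a) * (2 * b) / Real.pi) - Real.log (a - y) / 2,
      measurable_indicator_densF, indicator_densF_nonneg hα ha hab hφ, ?_, rfl, fun y => ?_⟩
    · exact (integrable_const _).sub ((integrable_log_eqMeasure hα ha hab hφ a).div_const 2)
    · exact indicator_apply_le' (fun hy => densF_le hα ha hy) fun _ => (Real.exp_pos _).le

end BetaEnsemble

/-- Convergence of the mean empirical measure of the eigenvalues conditioned to lie
in `[σ, ∞)` to the equilibrium measure with density `f_{α,a,b}` on `(a, b]`:
for every bounded continuous `g`,
`∫ (1/n) Σᵢ g(xᵢ) dP_n → ∫_a^b g(x) f_{α,a,b}(x) dx`. -/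
theorem mean_empirical_measure_tendsto (β α σ a b : ℝ) (μ : ℕ → ℝ)
    (hβ : 0 < β) (hα : 0 < α) (hσ : 0 < σ)
    (hμ0 : ∀ n, 0 ≤ μ n) (hμ : Tendsto (fun n : ℕ => μ n / n) atTop (𝓝 α))
    (hσa : σ ≤ a) (hab : a < b)
    (hψ : psiFun α b a = 0) (hφ : 0 ≤ phiFun α b a)
    (hcase : a = σ ∨ phiFun α b a = 0) :
    ∀ g : ℝ → ℝ, Continuous g → (∃ M : ℝ, ∀ x, |g x| ≤ M) →
      Tendsto
        (fun n : ℕ =>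
          (∫ x in {x : Fin n → ℝ | ∀ i, σ ≤ x i},
              ((1 / (n : ℝ)) * ∑ i, g (x i)) * eigDens β (μ n) n x) /
            ∫ x in {x : Fin n → ℝ | ∀ i, σ ≤ x i}, eigDens β (μ n) n x)
        atTop (𝓝 (∫ x in Set.Ioo a b, g x * densF α a b x)) := by
  rintro g hg ⟨M, hM⟩
  obtain ⟨ℓ, C, h⟩ := BetaEnsemble.exists_isEquilibrium_eqMeasure hα.le hσ hσa hab hψ hφ hcase
  have key := h.tendsto_mean_empirical hβ hα hσ hσa hμ hg hM
  rw [BetaEnsemble.integral_eqMeasure_eq hα.le (hσ.trans_le hσa) hab hφ] at key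
  simp only [mul_comm (densF α a b _)] at key
  exact key
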